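/- arXiv:1203.5022 — 3 statements merged into one kernel-verified Lean document; each statement's English description precedes it below -/
import Mathlib

section
/- Fix a real p ≥ 1 and set d_n = n − n^{2/3} for integers n ≥ 1. There exists a constant C_p > 0 depending only on p such that for every sufficiently large integer n and every positive zero α of J_n, one has ( ∫_0^{d_n} z |J_n(z)|^p dz / ∫_0^{α} z |J_n(z)|^p dz )^{1/p} < C_p · n^{1/3 + 2/(3p)} · 2^{−n^{1/3}/3}. Moreover, for each fixed k ≥ 1, this quantity with α = j_{n,k} tends to 0 as n → ∞, while (d_n / j_{n,k})² tends to 1 as n → ∞. (The displayed ratio of radial integrals equals the ratio ‖u_{n,k}‖_{L_p(D_{n,k})}/‖u_{n,k}‖_{L_p(D)} for the Dirichlet Laplacian eigenfunction u_{n,k}(r,φ) = J_n(j_{n,k} r/R) cos(nφ) of the disk D of radius R, where D_{n,k} is the concentric disk of radius R·d_n/j_{n,k}; thus whispering gallery modes localize near the boundary.) -/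
open Real MeasureTheory Filter Topology

/-- The Bessel function of the first kind of order `ν`. -/
noncomputable def besselJ (ν : ℝ) (x : ℝ) : ℝ :=
  ∑' k : ℕ, ((-1 : ℝ) ^ k / ((k.factorial : ℝ) * Real.Gamma ((k : ℝ) + ν + 1))) *
    (x / 2) ^ (2 * (k : ℝ) + ν)

/-- `d_n = n - n^{2/3}`. -/
noncomputable def dseq (n : ℕ) : ℝ := (n : ℝ) - (n : ℝ) ^ ((2 : ℝ) / 3)

/-- The ratio `( ∫_0^{d_n} z |J_n(z)|^p dz / ∫_0^α z |J_n(z)|^p dz )^{1/p}`, which equals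
`‖u_{n,k}‖_{L_p(D_{n,k})}/‖u_{n,k}‖_{L_p(D)}` for the disk eigenfunctions. -/
noncomputable def diskRatio (p : ℝ) (n : ℕ) (α : ℝ) : ℝ :=
  ((∫ z in (0 : ℝ)..dseq n, z * |besselJ n z| ^ p) /
    (∫ z in (0 : ℝ)..α, z * |besselJ n z| ^ p)) ^ (1 / p)

noncomputable def wgG (j n : ℕ) (s : ℝ) : ℝ :=
  ∑' k : ℕ, ((-1 : ℝ) ^ k / ((k.factorial : ℝ) * ((k + n).factorial : ℝ))) *
    ((2 * k + n : ℕ) : ℝ) ^ j * Real.exp (((2 * k + n : ℕ) : ℝ) * s)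

noncomputable def wgT (j n : ℕ) (s : ℝ) (k : ℕ) : ℝ :=
  (1 / ((k.factorial : ℝ) * ((k + n).factorial : ℝ))) *
    ((2 * k + n : ℕ) : ℝ) ^ j * Real.exp (((2 * k + n : ℕ) : ℝ) * s)

lemma wgT_summable (j n : ℕ) (s : ℝ) : Summable (wgT j n s) := by
  have h := (Real.summable_pow_div_factorial (Real.exp (2 * (j + s)))).mul_left
    (Real.exp (n * (j + s)))
  refine Summable.of_nonneg_of_le (fun k => by unfold wgT; positivity) (fun k => ?_) h
  unfold wgT
  have h1 : (1 : ℝ) / ((k.factorial : ℝ) * ((k + n).factorial : ℝ)) ≤ 1 / (k.factorial : ℝ) := by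
    apply one_div_le_one_div_of_le (by positivity)
    have : (1 : ℝ) ≤ ((k + n).factorial : ℝ) := by exact_mod_cast Nat.factorial_pos _
    nlinarith [show (0 : ℝ) < k.factorial by positivity]
  have h2 : ((2 * k + n : ℕ) : ℝ) ^ j ≤ Real.exp (((2 * k + n : ℕ) : ℝ) * j) := by
    rw [mul_comm _ (j : ℝ), Real.exp_nat_mul]
    gcongr
    linarith [Real.add_one_le_exp ((2 * k + n : ℕ) : ℝ)]
  calc _ ≤ 1 / (k.factorial : ℝ) * Real.exp (((2 * k + n : ℕ) : ℝ) * j)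
        * Real.exp (((2 * k + n : ℕ) : ℝ) * s) := by gcongr
    _ = _ := by
      rw [← Real.exp_nat_mul, mul_assoc, ← Real.exp_add, mul_div_assoc', ← Real.exp_add,
        one_div_mul_eq_div]
      congr 2
      push_cast
      ring

lemma wg_norm (j n : ℕ) (s : ℝ) (k : ℕ) :
    ‖((-1 : ℝ) ^ k / ((k.factorial : ℝ) * ((k + n).factorial : ℝ))) *
    ((2 * k + n : ℕ) : ℝ) ^ j * Real.exp (((2 * k + n : ℕ) : ℝ) * s)‖ = wgT j n s k := by
  unfold wgT
  rw [norm_mul, norm_mul, norm_div, norm_pow, norm_mul, norm_pow, norm_neg, norm_one, one_pow,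
    Real.norm_natCast, Real.norm_natCast, Real.norm_natCast, Real.norm_eq_abs, Real.abs_exp]

lemma wgT_mono (j n : ℕ) {s t : ℝ} (h : s ≤ t) (k : ℕ) : wgT j n s k ≤ wgT j n t k := by
  unfold wgT
  gcongr

lemma wg_summable (j n : ℕ) (s : ℝ) : Summable (fun k : ℕ =>
    ((-1 : ℝ) ^ k / ((k.factorial : ℝ) * ((k + n).factorial : ℝ))) *
    ((2 * k + n : ℕ) : ℝ) ^ j * Real.exp (((2 * k + n : ℕ) : ℝ) * s)) :=
  Summable.of_norm (by simp_rw [wg_norm]; exact wgT_summable j n s)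

lemma wgG_hasDerivAt (j n : ℕ) (s : ℝ) : HasDerivAt (wgG j n) (wgG (j + 1) n s) s := by
  have hmem : s ∈ Set.Iio (s + 1) := lt_add_one s
  refine hasDerivAt_tsum_of_isPreconnected (t := Set.Iio (s + 1)) (y₀ := s)
    (g := fun k y => ((-1 : ℝ) ^ k / ((k.factorial : ℝ) * ((k + n).factorial : ℝ))) *
      ((2 * k + n : ℕ) : ℝ) ^ j * Real.exp (((2 * k + n : ℕ) : ℝ) * y))
    (g' := fun k y => ((-1 : ℝ) ^ k / ((k.factorial : ℝ) * ((k + n).factorial : ℝ))) *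
      ((2 * k + n : ℕ) : ℝ) ^ (j + 1) * Real.exp (((2 * k + n : ℕ) : ℝ) * y))
    (wgT_summable (j + 1) n (s + 1)) isOpen_Iio isPreconnected_Iio
    (fun k y _ => ?_) (fun k y hy => ?_) hmem (wg_summable j n s) hmem
  · have := (((hasDerivAt_id y).const_mul ((2 * k + n : ℕ) : ℝ)).exp).const_mul
      (((-1 : ℝ) ^ k / ((k.factorial : ℝ) * ((k + n).factorial : ℝ))) *
        ((2 * k + n : ℕ) : ℝ) ^ j)
    refine this.congr_deriv ?_
    simp only [id]
    ring
  · rw [wg_norm]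
    exact wgT_mono _ _ (le_of_lt hy) _

lemma wgG_ode (n : ℕ) (s : ℝ) :
    wgG 2 n s = ((n : ℝ) ^ 2 - (2 * Real.exp s) ^ 2) * wgG 0 n s := by
  have h2 := wg_summable 2 n s
  have h0 := wg_summable 0 n s
  have key : wgG 2 n s - (n : ℝ) ^ 2 * wgG 0 n s = - (2 * Real.exp s) ^ 2 * wgG 0 n s := by
    unfold wgG
    rw [← tsum_mul_left, ← tsum_mul_left, ← (h2.tsum_sub (h0.mul_left _)),
      (h2.sub (h0.mul_left ((n : ℝ) ^ 2))).tsum_eq_zero_add]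
    simp only [Nat.mul_zero, zero_add]
    rw [show ∀ a b c : ℝ, a = 0 → b = c → a + b = c from fun a b c h h' => by rw [h, h', zero_add]]
    · ring
    · congr 1
      ext k
      have e : Real.exp (((2 * (k + 1) + n : ℕ) : ℝ) * s)
          = Real.exp s ^ 2 * Real.exp (((2 * k + n : ℕ) : ℝ) * s) := by
        rw [← Real.exp_nat_mul, ← Real.exp_add]
        congr 1
        push_cast
        ring
      rw [e, show k + 1 + n = (k + n) + 1 by ring, Nat.factorial_succ, Nat.factorial_succ]
      have : (k.factorial : ℝ) ≠ 0 := by positivity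
      have : ((k + n).factorial : ℝ) ≠ 0 := by positivity
      have : (k : ℝ) + 1 ≠ 0 := by positivity
      have : (k : ℝ) + n + 1 ≠ 0 := by positivity
      push_cast
      field_simp
      ring
  linarith

lemma wgG_bound (j n : ℕ) (hn : 1 ≤ n) (s : ℝ) (hs : s ≤ 0) :
    |wgG j n s| ≤ Real.exp s * ∑' k, wgT j n 0 k := by
  rw [← tsum_mul_left, ← Real.norm_eq_abs]
  unfold wgG
  refine tsum_of_norm_bounded ((wgT_summable j n 0).mul_left _).hasSum (fun k => ?_)
  rw [wg_norm]
  unfold wgT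
  rw [mul_zero, Real.exp_zero, mul_one, mul_comm (Real.exp s)]
  gcongr
  have : (1 : ℝ) ≤ ((2 * k + n : ℕ) : ℝ) := by exact_mod_cast (by omega)
  nlinarith

lemma wgG_tendsto (j n : ℕ) (hn : 1 ≤ n) : Tendsto (wgG j n) atBot (𝓝 0) := by
  have h : Tendsto (fun s => Real.exp s * ∑' k, wgT j n 0 k) atBot (𝓝 0) := by
    simpa using Real.tendsto_exp_atBot.mul_const (∑' k, wgT j n 0 k)
  refine squeeze_zero_norm' ?_ h
  filter_upwards [eventually_le_atBot 0] with s hs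
  exact wgG_bound j n hn s hs

lemma wgG_near (n : ℕ) : ∀ᶠ s in atBot, wgG 0 n s ≠ 0 := by
  have h : Tendsto (fun s => Real.exp s * ∑' k, wgT 0 n 0 (k + 1)) atBot (𝓝 0) := by
    simpa using Real.tendsto_exp_atBot.mul_const (∑' k, wgT 0 n 0 (k + 1))
  have hpos : (0 : ℝ) < 1 / n.factorial := by positivity
  filter_upwards [eventually_le_atBot 0, h.eventually_lt_const hpos] with s hs hlt
  have h0 := wg_summable 0 n s
  unfold wgG
  rw [h0.tsum_eq_zero_add]
  set R : ℝ := ∑' k : ℕ, ((-1 : ℝ) ^ (k + 1) / (((k + 1).factorial : ℝ) *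
    ((k + 1 + n).factorial : ℝ))) * ((2 * (k + 1) + n : ℕ) : ℝ) ^ 0 *
      Real.exp (((2 * (k + 1) + n : ℕ) : ℝ) * s) with hR
  have hb : ‖R‖ ≤ Real.exp (n * s) * (Real.exp s * ∑' k, wgT 0 n 0 (k + 1)) := by
    rw [← mul_assoc, ← tsum_mul_left]
    have hsum := (((summable_nat_add_iff 1).2 (wgT_summable 0 n 0)).mul_left
      (Real.exp (n * s) * Real.exp s))
    refine tsum_of_norm_bounded hsum.hasSum (fun k => ?_)
    rw [wg_norm]
    unfold wgT
    rw [mul_zero, Real.exp_zero, mul_one, mul_comm (Real.exp _ * _), ← Real.exp_add]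
    gcongr
    push_cast
    nlinarith [show (0 : ℝ) ≤ k by positivity]
  intro h
  rw [Real.norm_eq_abs, abs_le] at hb
  have := mul_lt_mul_of_pos_left hlt (Real.exp_pos (n * s))
  simp at h this
  have e : (n.factorial : ℝ)⁻¹ * Real.exp (n * s) = Real.exp (n * s) * (n.factorial : ℝ)⁻¹ :=
    mul_comm _ _
  linarith [hb.1]

lemma besselJ_eq (n : ℕ) (x : ℝ) : besselJ n x = ∑' k : ℕ,
    ((-1 : ℝ) ^ k / ((k.factorial : ℝ) * ((k + n).factorial : ℝ))) * (x / 2) ^ (2 * k + n) := by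
  unfold besselJ
  congr 1
  ext k
  rw [show (k : ℝ) + n + 1 = ((k + n : ℕ) : ℝ) + 1 by push_cast; ring, Real.Gamma_nat_eq_factorial,
    show (2 * (k : ℝ) + n) = ((2 * k + n : ℕ) : ℝ) by push_cast; ring, Real.rpow_natCast]

lemma besselJ_exp (n : ℕ) (s : ℝ) : besselJ n (2 * Real.exp s) = wgG 0 n s := by
  rw [besselJ_eq]
  unfold wgG
  congr 1
  ext k
  rw [mul_div_cancel_left₀ _ (by norm_num : (2 : ℝ) ≠ 0), ← Real.exp_nat_mul]
  ring_nf

lemma besselJ_log (n : ℕ) (x : ℝ) (hx : 0 < x) : besselJ n x = wgG 0 n (Real.log (x / 2)) := by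
  rw [← besselJ_exp, Real.exp_log (by positivity)]
  ring_nf

lemma besselJ_cont (n : ℕ) (b : ℝ) : ContinuousOn (besselJ n) (Set.Icc 0 b) := by
  have : besselJ n = fun x => ∑' k : ℕ,
    ((-1 : ℝ) ^ k / ((k.factorial : ℝ) * ((k + n).factorial : ℝ))) * (x / 2) ^ (2 * k + n) :=
    funext (besselJ_eq n)
  rw [this]
  have hs := wgT_summable 0 n (Real.log ((|b| + 1) / 2))
  refine continuousOn_tsum (fun k => by fun_prop) hs (fun k x hx => ?_)
  unfold wgT
  rw [Real.exp_nat_mul, Real.exp_log (by positivity), norm_mul, norm_div, norm_pow, norm_mul,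
    norm_pow, norm_neg, norm_one, one_pow, Real.norm_natCast, Real.norm_natCast, pow_zero, mul_one,
    Real.norm_eq_abs, abs_of_nonneg (by linarith [hx.1])]
  have := hx.1
  gcongr
  linarith [hx.2, le_abs_self b]

/-- Monotone on a left ray plus zero limit gives nonnegativity. -/
lemma wg_nonneg_of_deriv {f f' : ℝ → ℝ} {L : ℝ} (hf : ∀ s, HasDerivAt f (f' s) s)
    (hpos : ∀ s ≤ L, 0 ≤ f' s) : MonotoneOn f (Set.Iic L) := by
  refine monotoneOn_of_deriv_nonneg (convex_Iic L)
    (fun s _ => (hf s).continuousAt.continuousWithinAt)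
    (fun s _ => (hf s).differentiableAt.differentiableWithinAt) (fun s hs => ?_)
  rw [(hf s).deriv]
  exact hpos s (interior_subset (s := Set.Iic L) hs)

lemma wg_nonneg_of_lim {f : ℝ → ℝ} {L : ℝ} (hf : MonotoneOn f (Set.Iic L))
    (h0 : Tendsto f atBot (𝓝 0)) (s : ℝ) (hs : s ≤ L) : 0 ≤ f s := by
  refine le_of_tendsto h0 ?_
  filter_upwards [eventually_le_atBot s] with t ht
  exact hf (le_trans ht hs) hs ht

lemma wg_H_deriv (n : ℕ) (s : ℝ) : HasDerivAt (fun s => wgG 0 n s * wgG 1 n s)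
    (wgG 1 n s ^ 2 + ((n : ℝ) ^ 2 - (2 * Real.exp s) ^ 2) * wgG 0 n s ^ 2) s := by
  refine ((wgG_hasDerivAt 0 n s).mul (wgG_hasDerivAt 1 n s)).congr_deriv ?_
  simp only [zero_add, Nat.reduceAdd]
  rw [wgG_ode]
  ring

lemma wg_sq_deriv (j n : ℕ) (s : ℝ) : HasDerivAt (fun s => wgG j n s ^ 2)
    (2 * (wgG j n s * wgG (j + 1) n s)) s := by
  refine ((wgG_hasDerivAt j n s).pow 2).congr_deriv ?_
  push_cast
  ring

lemma wg_H_nonneg (n : ℕ) (hn : 1 ≤ n) (s : ℝ) (hs : 2 * Real.exp s ≤ n) :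
    0 ≤ wgG 0 n s * wgG 1 n s := by
  have hm := wg_nonneg_of_deriv (L := s) (wg_H_deriv n) (fun t ht => by
    have h1 : Real.exp t ≤ Real.exp s := Real.exp_le_exp.2 ht
    have h2 := Real.exp_pos t
    have h3 : 0 ≤ (n : ℝ) ^ 2 - (2 * Real.exp t) ^ 2 := by nlinarith
    positivity)
  refine wg_nonneg_of_lim hm ?_ s le_rfl
  simpa using (wgG_tendsto 0 n hn).mul (wgG_tendsto 1 n hn)

lemma wg_sq_mono (n : ℕ) (hn : 1 ≤ n) (L : ℝ) (hs : 2 * Real.exp L ≤ n) :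
    MonotoneOn (fun s => wgG 0 n s ^ 2) (Set.Iic L) :=
  wg_nonneg_of_deriv (wg_sq_deriv 0 n) (fun t ht => by
    have := wg_H_nonneg n hn t (by linarith [Real.exp_le_exp.2 ht])
    simpa using this)

lemma wg_sq_pos (n : ℕ) (hn : 1 ≤ n) (L : ℝ) (hs : 2 * Real.exp L ≤ n) :
    0 < wgG 0 n L ^ 2 := by
  obtain ⟨t, ht, ht'⟩ := ((wgG_near n).and (eventually_le_atBot L)).exists
  have := wg_sq_mono n hn L hs (a := t) ht' (b := L) (le_refl L) ht'
  have h2 : 0 < wgG 0 n t ^ 2 := by positivity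
  exact lt_of_lt_of_le h2 this

lemma wg_growth (n : ℕ) (hn : 1 ≤ n) (κ : ℝ) (hκ : 0 ≤ κ) (L : ℝ)
    (hs : κ ^ 2 ≤ (n : ℝ) ^ 2 - (2 * Real.exp L) ^ 2) :
    MonotoneOn (fun s => wgG 0 n s ^ 2 * Real.exp (-(2 * κ * s))) (Set.Iic L) := by
  have hle : ∀ t ≤ L, 2 * Real.exp t ≤ n := fun t ht => by
    have h1 : Real.exp t ≤ Real.exp L := Real.exp_le_exp.2 ht
    have h2 := Real.exp_pos t
    have h3 : (2 * Real.exp t) ^ 2 ≤ (n : ℝ) ^ 2 := by nlinarith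
    exact (le_abs_self _).trans (abs_le_of_sq_le_sq h3 (by positivity))
  have hd : ∀ s, HasDerivAt (fun s => wgG 1 n s ^ 2 - κ ^ 2 * wgG 0 n s ^ 2)
      (2 * ((n : ℝ) ^ 2 - (2 * Real.exp s) ^ 2 - κ ^ 2) * (wgG 0 n s * wgG 1 n s)) s := fun s => by
    refine ((wg_sq_deriv 1 n s).sub ((wg_sq_deriv 0 n s).const_mul (κ ^ 2))).congr_deriv ?_
    simp only [zero_add, Nat.reduceAdd]
    rw [wgG_ode]
    ring
  have hmono := wg_nonneg_of_deriv (L := L) hd (fun t ht => by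
    have h1 : Real.exp t ≤ Real.exp L := Real.exp_le_exp.2 ht
    have h2 := Real.exp_pos t
    have h3 : 0 ≤ (n : ℝ) ^ 2 - (2 * Real.exp t) ^ 2 - κ ^ 2 := by nlinarith
    have := wg_H_nonneg n hn t (hle t ht)
    positivity)
  have hlim : Tendsto (fun s => wgG 1 n s ^ 2 - κ ^ 2 * wgG 0 n s ^ 2) atBot (𝓝 0) := by
    simpa using ((wgG_tendsto 1 n hn).pow 2).sub (((wgG_tendsto 0 n hn).pow 2).const_mul (κ ^ 2))
  have hnn := wg_nonneg_of_lim hmono hlim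
  have hd2 : ∀ s, HasDerivAt (fun s => wgG 0 n s ^ 2 * Real.exp (-(2 * κ * s)))
      (2 * (wgG 0 n s * wgG 1 n s - κ * wgG 0 n s ^ 2) * Real.exp (-(2 * κ * s))) s := fun s => by
    have he : HasDerivAt (fun s : ℝ => Real.exp (-(2 * κ * s)))
        (Real.exp (-(2 * κ * s)) * (-(2 * κ * 1))) s :=
      (((hasDerivAt_id s).const_mul (2 * κ)).neg).exp
    refine ((wg_sq_deriv 0 n s).mul he).congr_deriv ?_
    simp only [zero_add]
    ring
  refine wg_nonneg_of_deriv hd2 (fun t ht => ?_)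
  have h1 := hnn t ht
  have h2 := wg_H_nonneg n hn t (hle t ht)
  have h3 : κ * wgG 0 n t ^ 2 ≤ wgG 0 n t * wgG 1 n t := by
    refine (le_abs_self _).trans (abs_le_of_sq_le_sq ?_ h2)
    nlinarith [sq_nonneg (wgG 0 n t)]
  have h4 := Real.exp_pos (-(2 * κ * t))
  have h5 : 0 ≤ wgG 0 n t * wgG 1 n t - κ * wgG 0 n t ^ 2 := by linarith
  positivity

/-- Sturm comparison. -/
lemma wg_sturm (n : ℕ) (lam A : ℝ) (hl : 0 < lam)
    (hq : lam ^ 2 ≤ (2 * Real.exp A) ^ 2 - (n : ℝ) ^ 2) :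
    ∃ s ∈ Set.Icc A (A + π / lam), wgG 0 n s = 0 := by
  by_contra! hne
  have hpl : 0 < π / lam := div_pos Real.pi_pos hl
  set B := A + π / lam with hB
  have hAB : A < B := by linarith
  have hcont : ContinuousOn (wgG 0 n) (Set.Icc A B) :=
    fun s _ => (wgG_hasDerivAt 0 n s).continuousAt.continuousWithinAt
  -- constant sign
  have hsign : ∀ s ∈ Set.Icc A B, 0 < wgG 0 n A * wgG 0 n s := by
    intro s hs
    by_contra! hle
    have hc2 : ContinuousOn (fun u => wgG 0 n A * wgG 0 n u) (Set.Icc A s) :=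
      (hcont.mono (Set.Icc_subset_Icc_right hs.2)).const_smul (wgG 0 n A)
    have := intermediate_value_Icc' hs.1 hc2
    have hA0 := hne A ⟨le_rfl, hAB.le⟩
    obtain ⟨u, hu, hu0⟩ := this ⟨hle, mul_self_nonneg (wgG 0 n A)⟩
    have := hne u ⟨hu.1, hu.2.trans hs.2⟩
    exact (mul_ne_zero hA0 this) hu0
  set c := wgG 0 n A with hc
  let W : ℝ → ℝ := fun s => c * (wgG 1 n s * Real.sin (lam * (s - A))
    - wgG 0 n s * (lam * Real.cos (lam * (s - A))))
  have hW : ∀ s, HasDerivAt W ((lam ^ 2 + ((n : ℝ) ^ 2 - (2 * Real.exp s) ^ 2)) *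
      (c * wgG 0 n s) * Real.sin (lam * (s - A))) s := fun s => by
    have hlin : HasDerivAt (fun s : ℝ => lam * (s - A)) (lam * 1) s :=
      ((hasDerivAt_id s).sub_const A).const_mul lam
    refine ((((wgG_hasDerivAt 1 n s).mul hlin.sin).sub
      ((wgG_hasDerivAt 0 n s).mul (hlin.cos.const_mul lam))).const_mul c).congr_deriv ?_
    simp only [zero_add, Nat.reduceAdd]
    rw [wgG_ode]
    ring
  have hanti : AntitoneOn W (Set.Icc A B) := by
    refine antitoneOn_of_deriv_nonpos (convex_Icc A B)
      (fun s _ => (hW s).continuousAt.continuousWithinAt)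
      (fun s _ => (hW s).differentiableAt.differentiableWithinAt) (fun s hs => ?_)
    rw [(hW s).deriv]
    have hs' := interior_subset (s := Set.Icc A B) hs
    have h1 := hsign s hs'
    have h2 : 0 ≤ Real.sin (lam * (s - A)) := by
      apply Real.sin_nonneg_of_nonneg_of_le_pi
      · exact mul_nonneg hl.le (by linarith [hs'.1])
      · have : s - A ≤ π / lam := by linarith [hs'.2]
        rw [le_div_iff₀ hl] at this
        linarith
    have h3 : Real.exp A ≤ Real.exp s := Real.exp_le_exp.2 hs'.1
    have h4 := Real.exp_pos A
    have h5 : lam ^ 2 + ((n : ℝ) ^ 2 - (2 * Real.exp s) ^ 2) ≤ 0 := by nlinarith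
    exact mul_nonpos_of_nonpos_of_nonneg (mul_nonpos_of_nonpos_of_nonneg h5 h1.le) h2
  have h := hanti (a := A) ⟨le_rfl, hAB.le⟩ (b := B) ⟨hAB.le, le_rfl⟩ hAB.le
  have e : lam * (B - A) = π := by rw [hB]; field_simp; ring
  simp only [W, e, sub_self, mul_zero, Real.sin_zero, Real.cos_zero, Real.sin_pi, Real.cos_pi] at h
  have h1 := mul_pos hl (hsign A ⟨le_rfl, hAB.le⟩)
  have h2 := mul_pos hl (hsign B ⟨hAB.le, le_rfl⟩)
  nlinarith

lemma two_exp_log (x : ℝ) (hx : 0 < x) : 2 * Real.exp (Real.log (x / 2)) = x := by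
  rw [Real.exp_log (by positivity)]
  ring

lemma besselJ_abs_mono (n : ℕ) (hn : 1 ≤ n) (x y : ℝ) (hx : 0 < x) (hxy : x ≤ y)
    (hy : y ≤ n) : |besselJ n x| ≤ |besselJ n y| := by
  have hy0 := hx.trans_le hxy
  rw [besselJ_log n x hx, besselJ_log n y hy0, ← sq_le_sq]
  have hl : Real.log (x / 2) ≤ Real.log (y / 2) := Real.log_le_log (by positivity) (by linarith)
  exact wg_sq_mono n hn (Real.log (y / 2)) (by rwa [two_exp_log y hy0]) hl
    (Set.mem_Iic.2 le_rfl) hl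

lemma besselJ_ne_zero (n : ℕ) (hn : 1 ≤ n) (x : ℝ) (hx : 0 < x) (hy : x ≤ n) :
    besselJ n x ≠ 0 := by
  rw [besselJ_log n x hx]
  have := wg_sq_pos n hn (Real.log (x / 2)) (by rwa [two_exp_log x hx])
  intro h
  rw [h] at this
  norm_num at this

lemma besselJ_growth (n : ℕ) (hn : 1 ≤ n) (κ x y : ℝ) (hκ : 0 ≤ κ) (hx : 0 < x) (hxy : x ≤ y)
    (hy : κ ^ 2 ≤ (n : ℝ) ^ 2 - y ^ 2) :
    |besselJ n x| ≤ Real.exp (κ * (Real.log x - Real.log y)) * |besselJ n y| := by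
  have hy0 := hx.trans_le hxy
  have hl : Real.log (x / 2) ≤ Real.log (y / 2) := Real.log_le_log (by positivity) (by linarith)
  have := wg_growth n hn κ hκ (Real.log (y / 2)) (by rwa [two_exp_log y hy0]) hl
    (Set.mem_Iic.2 le_rfl) hl
  simp only at this
  rw [← besselJ_log n x hx, ← besselJ_log n y hy0, Real.log_div hx.ne' two_ne_zero,
    Real.log_div hy0.ne' two_ne_zero] at this
  refine abs_le_of_sq_le_sq ?_ (by positivity)
  rw [mul_pow, sq_abs, ← Real.exp_nat_mul]
  have h2 := mul_le_mul_of_nonneg_right this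
    (Real.exp_pos (2 * κ * (Real.log x - Real.log 2))).le
  rw [mul_assoc (besselJ n x ^ 2), ← Real.exp_add, mul_assoc (besselJ n y ^ 2),
    ← Real.exp_add] at h2
  rw [show -(2 * κ * (Real.log x - Real.log 2)) + 2 * κ * (Real.log x - Real.log 2) = 0 by ring,
    Real.exp_zero, mul_one, mul_comm] at h2
  convert h2 using 3
  push_cast
  ring

lemma wg_ratio (p : ℝ) (hp : 1 ≤ p) (n : ℕ) (r : ℝ) (hr : 2 ≤ r) (hnr : (n : ℝ) = r ^ 3)
    (hd : dseq n = r ^ 3 - r ^ 2) (α : ℝ) (hα : (n : ℝ) ≤ α) :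
    diskRatio p n α ≤ (2 * r) ^ (1 / p) * Real.exp (-r / 2) := by
  have hn : 1 ≤ n := by
    rcases Nat.eq_zero_or_pos n with h | h
    · rw [h] at hnr
      have : 0 < r ^ 3 := by positivity
      simp at hnr
      linarith
    · exact h
  have hp0 : 0 < p := by linarith
  set d := dseq n with hdd
  set m : ℝ := r ^ 3 - r ^ 2 / 2 with hm
  have hr2 : 0 < r ^ 2 := by positivity
  have hd0 : 0 < d := by rw [hd]; nlinarith
  have hdm : d ≤ m := by rw [hd, hm]; linarith
  have hm0 : 0 < m := hd0.trans_le hdm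
  have hmn : m ≤ n := by rw [hnr, hm]; linarith
  have hcont : ∀ b, ContinuousOn (fun z => z * |besselJ n z| ^ p) (Set.Icc 0 b) := fun b =>
    continuousOn_id.mul ((besselJ_cont n b).abs.rpow_const (fun _ _ => Or.inr hp0.le))
  have hint : ∀ a b, 0 ≤ a → a ≤ b →
      IntervalIntegrable (fun z => z * |besselJ n z| ^ p) volume a b := fun a b ha hab => by
    apply ContinuousOn.intervalIntegrable
    rw [Set.uIcc_of_le hab]
    exact (hcont b).mono (Set.Icc_subset_Icc_left ha)
  have hN : (∫ z in (0 : ℝ)..d, z * |besselJ n z| ^ p) ≤ d * (d * |besselJ n d| ^ p) := by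
    have := intervalIntegral.integral_mono_on hd0.le (hint 0 d le_rfl hd0.le)
      (intervalIntegrable_const (c := d * |besselJ n d| ^ p)) (fun z hz => by
        rcases hz.1.eq_or_lt with h | h
        · rw [← h, zero_mul]; positivity
        · have := besselJ_abs_mono n hn z d h hz.2 (hdm.trans hmn)
          have := hz.2
          gcongr)
    simpa using this
  have hD : (n - m) * (m * |besselJ n m| ^ p) ≤ ∫ z in (0 : ℝ)..α, z * |besselJ n z| ^ p := by
    have h1 := intervalIntegral.integral_mono_on hmn
      (intervalIntegrable_const (c := m * |besselJ n m| ^ p)) (hint m n hm0.le hmn)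
      (fun z hz => by
        have := besselJ_abs_mono n hn m z hm0 hz.1 hz.2
        have h3 := hz.1
        have h4 := hm0.trans_le hz.1
        gcongr)
    have h2 := intervalIntegral.integral_mono_interval (μ := volume)
      (f := fun z => z * |besselJ n z| ^ p) (a := m) (b := n) (c := 0) (d := α) hm0.le hmn hα
      (by
        refine (ae_restrict_iff' measurableSet_Ioc).2 (Eventually.of_forall fun z hz => ?_)
        have := hz.1.le
        simp only [Pi.zero_apply]
        positivity) (hint 0 α le_rfl (by linarith))
    simp only [intervalIntegral.integral_const, smul_eq_mul] at h1
    linarith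
  have hN0 : 0 ≤ ∫ z in (0 : ℝ)..d, z * |besselJ n z| ^ p :=
    intervalIntegral.integral_nonneg hd0.le (fun z hz => by have := hz.1; positivity)
  have hJm : 0 < |besselJ n m| := abs_pos.2 (besselJ_ne_zero n hn m hm0 hmn)
  have hJmp : 0 < |besselJ n m| ^ p := Real.rpow_pos_of_pos hJm p
  have hnm : (n : ℝ) - m = r ^ 2 / 2 := by rw [hnr, hm]; ring
  have hlog : Real.log d - Real.log m ≤ -(1 / (2 * r)) := by
    rw [← Real.log_div hd0.ne' hm0.ne']
    have h1 := Real.log_le_sub_one_of_pos (div_pos hd0 hm0)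
    have h2 : d / m - 1 ≤ -(1 / (2 * r)) := by
      have e : d / m = 1 - r ^ 2 / 2 / m := by
        rw [eq_sub_iff_add_eq, ← add_div, div_eq_one_iff_eq hm0.ne', hd, hm]; ring
      have h3 : 1 / (2 * r) ≤ r ^ 2 / 2 / m := by
        rw [div_le_div_iff₀ (by positivity) hm0, hm]
        nlinarith
      linarith
    linarith
  have hgr : |besselJ n d| ≤ Real.exp (-r / 2) * |besselJ n m| := by
    have := besselJ_growth n hn (r ^ 2) d m (by positivity) hd0 hdm (by
      rw [hnr, hm]
      have : 0 ≤ r ^ 4 * (r - 5 / 4) := by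
        have : 0 ≤ r - 5 / 4 := by linarith
        positivity
      nlinarith)
    refine this.trans ?_
    gcongr
    calc r ^ 2 * (Real.log d - Real.log m) ≤ r ^ 2 * (-(1 / (2 * r))) := by gcongr
      _ = -r / 2 := by field_simp
  have hgp : |besselJ n d| ^ p ≤ Real.exp (-r / 2) ^ p * |besselJ n m| ^ p := by
    rw [← Real.mul_rpow (by positivity) (by positivity)]
    gcongr
  have hDpos : 0 < (n - m) * (m * |besselJ n m| ^ p) := by
    rw [hnm]; positivity
  unfold diskRatio
  have hq : (∫ z in (0 : ℝ)..d, z * |besselJ n z| ^ p) /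
      (∫ z in (0 : ℝ)..α, z * |besselJ n z| ^ p) ≤ 2 * r * Real.exp (-r / 2) ^ p := by
    calc _ ≤ d * (d * |besselJ n d| ^ p) / ((n - m) * (m * |besselJ n m| ^ p)) := by gcongr
      _ ≤ 2 * r * Real.exp (-r / 2) ^ p := by
        rw [div_le_iff₀ hDpos, hnm]
        have hdr : d ≤ r ^ 3 := by rw [hd]; linarith
        calc d * (d * |besselJ n d| ^ p)
            ≤ r ^ 3 * (m * (Real.exp (-r / 2) ^ p * |besselJ n m| ^ p)) := by gcongr
          _ = _ := by ring
  calc _ ≤ (2 * r * Real.exp (-r / 2) ^ p) ^ (1 / p) := by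
        apply Real.rpow_le_rpow _ hq (by positivity)
        exact div_nonneg hN0 (hDpos.le.trans hD)
    _ = _ := by
        rw [Real.mul_rpow (by positivity) (by positivity), ← Real.rpow_mul (by positivity),
          mul_one_div_cancel hp0.ne', Real.rpow_one]

lemma wg_zero_exists (a b : ℝ) (ha : 1 < a) (hab : a < b) :
    ∀ᶠ n : ℕ in atTop, ∃ x, a * n ≤ x ∧ x ≤ b * n ∧ besselJ n x = 0 := by
  set c := √(a ^ 2 - 1) with hc
  have hc0 : 0 < c := Real.sqrt_pos.2 (by nlinarith)
  have hl : 0 < Real.log b - Real.log a := sub_pos.2 (Real.log_lt_log (by linarith) hab)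
  filter_upwards [eventually_ge_atTop 1,
    (tendsto_natCast_atTop_atTop (R := ℝ)).eventually_ge_atTop
      (π / (c * (Real.log b - Real.log a)))] with n hn hn2
  have hn0 : (0 : ℝ) < n := by exact_mod_cast hn
  have han : 0 < a * n := by positivity
  have hbn : 0 < b * n := by have : 0 < b := by linarith
                             positivity
  obtain ⟨s, hs, hs0⟩ := wg_sturm n (c * n) (Real.log (a * n / 2)) (by positivity) (by
    rw [two_exp_log _ han, mul_pow, hc, Real.sq_sqrt (by nlinarith)]
    apply le_of_eq
    ring)
  refine ⟨2 * Real.exp s, ?_, ?_, by rw [besselJ_exp, hs0]⟩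
  · calc a * n = 2 * Real.exp (Real.log (a * n / 2)) := (two_exp_log _ han).symm
      _ ≤ _ := by have := hs.1; gcongr
  · calc 2 * Real.exp s ≤ 2 * Real.exp (Real.log (b * n / 2)) := by
          have h2 : π / (c * n) ≤ Real.log b - Real.log a := by
            rw [div_le_iff₀ (by positivity)] at hn2 ⊢
            linarith
          have h1 := hs.2
          rw [Real.log_div han.ne' two_ne_zero, Real.log_mul (by linarith) hn0.ne'] at h1
          have : s ≤ Real.log (b * n / 2) := by
            rw [Real.log_div hbn.ne' two_ne_zero, Real.log_mul (by linarith) hn0.ne']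
            linarith
          gcongr
      _ = b * n := two_exp_log _ hbn

lemma wg_j_le (j : ℕ → ℕ → ℝ)
    (hj_mono : ∀ (n k l : ℕ), 1 ≤ k → k < l → j n k < j n l)
    (hj_surj : ∀ (n : ℕ) (x : ℝ), 0 < x → besselJ n x = 0 → ∃ k, 1 ≤ k ∧ j n k = x) (k : ℕ) :
    ∀ b : ℝ, 1 < b → ∀ᶠ n : ℕ in atTop, j n (k + 1) ≤ b * n := by
  have hmono : ∀ n k l : ℕ, 1 ≤ k → k ≤ l → j n k ≤ j n l := fun n k l hk hkl => by
    rcases hkl.eq_or_lt with h | h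
    · rw [h]
    · exact (hj_mono n k l hk h).le
  induction k with
  | zero =>
    intro b hb
    filter_upwards [wg_zero_exists ((1 + b) / 2) b (by linarith) (by linarith),
      eventually_ge_atTop 1] with n ⟨x, hx1, hx2, hx0⟩ hn
    have hn0 : (0 : ℝ) < n := by exact_mod_cast hn
    obtain ⟨l, hl, rfl⟩ := hj_surj n x (by nlinarith) hx0
    exact (hmono n 1 l le_rfl hl).trans hx2
  | succ k ih =>
    intro b hb
    filter_upwards [wg_zero_exists ((1 + b) / 2) b (by linarith) (by linarith),
      eventually_ge_atTop 1, ih ((1 + (1 + b) / 2) / 2) (by linarith)]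
      with n ⟨x, hx1, hx2, hx0⟩ hn hk
    have hn0 : (0 : ℝ) < n := by exact_mod_cast hn
    obtain ⟨l, hl, rfl⟩ := hj_surj n x (by nlinarith) hx0
    have : k + 1 < l := by
      by_contra! hle
      have := hmono n l (k + 1) hl hle
      nlinarith
    exact (hmono n (k + 2) l (by omega) this).trans hx2

lemma wg_bound_tendsto (C a : ℝ) : Tendsto (fun n : ℕ => C * (n : ℝ) ^ a *
    (2 : ℝ) ^ (-(n : ℝ) ^ ((1 : ℝ) / 3) / 3)) atTop (𝓝 0) := by
  have hl : 0 < Real.log 2 / 3 := by have := Real.log_pos one_lt_two; positivity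
  have h1 := tendsto_rpow_mul_exp_neg_mul_atTop_nhds_zero (3 * a) (Real.log 2 / 3) hl
  have h2 : Tendsto (fun n : ℕ => (n : ℝ) ^ ((1 : ℝ) / 3)) atTop atTop :=
    (tendsto_rpow_atTop (by norm_num)).comp tendsto_natCast_atTop_atTop
  have h3 := (h1.comp h2).const_mul C
  rw [mul_zero] at h3
  refine h3.congr (fun n => ?_)
  simp only [Function.comp]
  rw [← Real.rpow_mul (by positivity), Real.rpow_def_of_pos (by norm_num : (0 : ℝ) < 2),
    show (1 : ℝ) / 3 * (3 * a) = a by ring]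
  ring_nf

theorem whispering_gallery_disk_dirichlet
    (p : ℝ) (hp : 1 ≤ p)
    (j : ℕ → ℕ → ℝ)
    (hj_pos : ∀ (n k : ℕ), 1 ≤ k → 0 < j n k)
    (hj_zero : ∀ (n k : ℕ), 1 ≤ k → besselJ n (j n k) = 0)
    (hj_mono : ∀ (n k l : ℕ), 1 ≤ k → k < l → j n k < j n l)
    (hj_surj : ∀ (n : ℕ) (x : ℝ), 0 < x → besselJ n x = 0 → ∃ k, 1 ≤ k ∧ j n k = x) :
    (∃ C : ℝ, 0 < C ∧ ∀ᶠ n : ℕ in atTop, ∀ α : ℝ, 0 < α → besselJ n α = 0 →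
        diskRatio p n α <
          C * (n : ℝ) ^ ((1 : ℝ) / 3 + 2 / (3 * p)) * (2 : ℝ) ^ (-(n : ℝ) ^ ((1 : ℝ) / 3) / 3))
    ∧ (∀ k : ℕ, 1 ≤ k →
        Tendsto (fun n : ℕ => diskRatio p n (j n k)) atTop (𝓝 0)
        ∧ Tendsto (fun n : ℕ => (dseq n / j n k) ^ 2) atTop (𝓝 1)) := by
  have hp0 : 0 < p := by linarith
  have hgt : ∀ n : ℕ, 1 ≤ n → ∀ α : ℝ, 0 < α → besselJ n α = 0 → (n : ℝ) ≤ α := by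
    intro n hn α hα h0
    by_contra! h
    exact besselJ_ne_zero n hn α hα h.le h0
  have hroot : Tendsto (fun n : ℕ => (n : ℝ) ^ ((1 : ℝ) / 3)) atTop atTop :=
    (tendsto_rpow_atTop (by norm_num)).comp tendsto_natCast_atTop_atTop
  have hA : ∀ᶠ n : ℕ in atTop, ∀ α : ℝ, 0 < α → besselJ n α = 0 →
        diskRatio p n α <
          3 * (n : ℝ) ^ ((1 : ℝ) / 3 + 2 / (3 * p)) *
            (2 : ℝ) ^ (-(n : ℝ) ^ ((1 : ℝ) / 3) / 3) := by
    filter_upwards [hroot.eventually_ge_atTop 2, eventually_ge_atTop 1] with n hr hn α hα h0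
    have hn0 : (0 : ℝ) ≤ n := by positivity
    have hn1 : (1 : ℝ) ≤ n := by exact_mod_cast hn
    set r := (n : ℝ) ^ ((1 : ℝ) / 3) with hrdef
    have hnr : (n : ℝ) = r ^ 3 := by
      rw [hrdef, ← Real.rpow_natCast, ← Real.rpow_mul hn0]
      norm_num
    have hd : dseq n = r ^ 3 - r ^ 2 := by
      rw [← hnr, dseq, hrdef, ← Real.rpow_natCast, ← Real.rpow_mul hn0]
      norm_num
    refine (wg_ratio p hp n r hr hnr hd α (hgt n hn α hα h0)).trans_lt ?_
    have h1 : (2 * r) ^ (1 / p) < 3 * (n : ℝ) ^ ((1 : ℝ) / 3 + 2 / (3 * p)) := by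
      rw [Real.mul_rpow (by norm_num) (by linarith), hrdef, ← Real.rpow_mul hn0]
      have h2 : (2 : ℝ) ^ (1 / p) ≤ 2 := by
        calc (2 : ℝ) ^ (1 / p) ≤ 2 ^ (1 : ℝ) :=
              Real.rpow_le_rpow_of_exponent_le (by norm_num) (by rw [div_le_one hp0]; exact hp)
          _ = 2 := by norm_num
      have h3 : (n : ℝ) ^ ((1 : ℝ) / 3 * (1 / p)) ≤ (n : ℝ) ^ ((1 : ℝ) / 3 + 2 / (3 * p)) := by
        apply Real.rpow_le_rpow_of_exponent_le hn1
        have : (2 : ℝ) / (3 * p) = 2 * (1 / 3 * (1 / p)) := by field_simp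
        have : 0 ≤ (1 : ℝ) / 3 * (1 / p) := by positivity
        linarith
      have h4 : 0 < (n : ℝ) ^ ((1 : ℝ) / 3 + 2 / (3 * p)) := by positivity
      have h5 : 0 < (n : ℝ) ^ ((1 : ℝ) / 3 * (1 / p)) := by positivity
      nlinarith
    have h2 : Real.exp (-r / 2) ≤ (2 : ℝ) ^ (-r / 3) := by
      rw [Real.rpow_def_of_pos (by norm_num : (0 : ℝ) < 2)]
      apply Real.exp_le_exp.2
      nlinarith [Real.log_two_lt_d9]
    exact mul_lt_mul h1 h2 (Real.exp_pos _) (by positivity)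
  refine ⟨⟨3, by norm_num, hA⟩, fun k hk => ⟨?_, ?_⟩⟩
  · refine squeeze_zero' ?_ ?_ (wg_bound_tendsto 3 ((1 : ℝ) / 3 + 2 / (3 * p)))
    · filter_upwards [eventually_ge_atTop 1] with n hn
      unfold diskRatio
      have hd : 0 ≤ dseq n := by
        unfold dseq
        have hn1 : (1 : ℝ) ≤ n := by exact_mod_cast hn
        have := Real.rpow_le_rpow_of_exponent_le hn1 (show (2 : ℝ) / 3 ≤ 1 by norm_num)
        rw [Real.rpow_one] at this
        linarith
      refine Real.rpow_nonneg (div_nonneg ?_ ?_) _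
      · exact intervalIntegral.integral_nonneg hd (fun z hz => by have := hz.1; positivity)
      · exact intervalIntegral.integral_nonneg (hj_pos n k hk).le
          (fun z hz => by have := hz.1; positivity)
    · filter_upwards [hA] with n h
      exact (h _ (hj_pos n k hk) (hj_zero n k hk)).le
  · have hj1 : Tendsto (fun n : ℕ => j n k / n) atTop (𝓝 1) := by
      rw [tendsto_order]
      obtain ⟨k, rfl⟩ : ∃ l, k = l + 1 := ⟨k - 1, by omega⟩
      constructor
      · intro a ha
        filter_upwards [eventually_ge_atTop 1] with n hn
        have hn0 : (0 : ℝ) < n := by exact_mod_cast hn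
        have := hgt n hn _ (hj_pos n _ hk) (hj_zero n _ hk)
        have : 1 ≤ j n (k + 1) / n := by rwa [le_div_iff₀ hn0, one_mul]
        linarith
      · intro b hb
        filter_upwards [eventually_ge_atTop 1,
          wg_j_le j hj_mono hj_surj k ((1 + b) / 2) (by linarith)] with n hn h
        have hn0 : (0 : ℝ) < n := by exact_mod_cast hn
        rw [div_lt_iff₀ hn0]
        nlinarith
    have hd1 : Tendsto (fun n : ℕ => dseq n / n) atTop (𝓝 1) := by
      have h1 : Tendsto (fun n : ℕ => 1 - ((n : ℝ) ^ ((1 : ℝ) / 3))⁻¹) atTop (𝓝 (1 - 0)) :=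
        hroot.inv_tendsto_atTop.const_sub 1
      rw [sub_zero] at h1
      refine h1.congr' ?_
      filter_upwards [eventually_ge_atTop 1] with n hn
      have hn0 : (0 : ℝ) < n := by exact_mod_cast hn
      unfold dseq
      rw [sub_div, div_self hn0.ne', ← Real.rpow_neg hn0.le]
      congr 1
      nth_rewrite 3 [← Real.rpow_one (n : ℝ)]
      rw [← Real.rpow_sub hn0]
      norm_num
    have h := (hd1.div hj1 one_ne_zero).pow 2
    rw [div_one, one_pow] at h
    refine h.congr' ?_
    filter_upwards [eventually_ge_atTop 1] with n hn
    have hn0 : (n : ℝ) ≠ 0 := by exact_mod_cast (by omega)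
    simp only [Pi.div_apply]
    rw [div_div_div_cancel_right₀ hn0]
end

section
/- Fix a real p ≥ 1 and set d_n = n − n^{2/3} for integers n ≥ 1. There exists a constant C_p > 0 depending only on p such that for every sufficiently large integer n and every positive zero α of the derivative J_n′, one has ( ∫_0^{d_n} z |J_n(z)|^p dz / ∫_0^{α} z |J_n(z)|^p dz )^{1/p} < C_p · n^{1/3 + 2/(3p)} · 2^{−n^{1/3}/3}. Moreover, for each fixed k ≥ 1, this quantity with α = j′_{n,k} tends to 0 as n → ∞, while (d_n / j′_{n,k})² tends to 1 as n → ∞. (This is the whispering-gallery localization estimate for the Neumann Laplacian eigenfunctions u_{n,k}(r,φ) = J_n(j′_{n,k} r/R) cos(nφ) of a disk of radius R.) -/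
open Real MeasureTheory Filter Topology

noncomputable def bh (m : ℕ) (y : ℝ) : ℝ :=
  ∑' k : ℕ, (-1 : ℝ) ^ k / ((k.factorial : ℝ) * ((k + m).factorial : ℝ)) * y ^ k

lemma bh_coeff_le (m k : ℕ) :
    |(-1 : ℝ) ^ k / ((k.factorial : ℝ) * ((k + m).factorial : ℝ))| ≤ 1 / (k.factorial : ℝ) := by
  have h1 : (0 : ℝ) < k.factorial := by positivity
  have h2 : (1 : ℝ) ≤ (k + m).factorial := by exact_mod_cast Nat.factorial_pos _
  rw [abs_div, abs_pow, abs_neg, abs_one, one_pow, abs_of_pos (by positivity)]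
  apply one_div_le_one_div_of_le h1
  nlinarith

lemma bh_summable (m : ℕ) (y : ℝ) :
    Summable (fun k : ℕ => (-1 : ℝ) ^ k / ((k.factorial : ℝ) * ((k + m).factorial : ℝ)) * y ^ k) := by
  refine Summable.of_norm_bounded (Real.summable_pow_div_factorial |y|) (fun k => ?_)
  rw [Real.norm_eq_abs, abs_mul, abs_pow]
  calc _ ≤ 1 / (k.factorial : ℝ) * |y| ^ k :=
        mul_le_mul_of_nonneg_right (bh_coeff_le m k) (by positivity)
    _ = _ := by ring

lemma bh_shift (m : ℕ) (y : ℝ) :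
    ∑' k : ℕ, (-1 : ℝ) ^ k / ((k.factorial : ℝ) * ((k + m).factorial : ℝ)) * (k * y ^ (k - 1))
      = - bh (m + 1) y := by
  have e : ∀ k : ℕ, (-1 : ℝ) ^ (k + 1) / (((k + 1).factorial : ℝ) * ((k + 1 + m).factorial : ℝ)) *
      (((k + 1 : ℕ) : ℝ) * y ^ (k + 1 - 1)) =
      - ((-1 : ℝ) ^ k / ((k.factorial : ℝ) * ((k + (m + 1)).factorial : ℝ)) * y ^ k) := by
    intro k
    have : k + 1 + m = k + (m + 1) := by ring
    rw [this, Nat.factorial_succ k]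
    have h1 : (k.factorial : ℝ) ≠ 0 := by positivity
    have h2 : ((k + (m + 1)).factorial : ℝ) ≠ 0 := by positivity
    push_cast
    have h3 : (k : ℝ) + 1 ≠ 0 := by positivity
    field_simp
    ring
  have hs : Summable (fun k : ℕ => (-1 : ℝ) ^ k / ((k.factorial : ℝ) * ((k + m).factorial : ℝ)) *
      (k * y ^ (k - 1))) := by
    rw [← summable_nat_add_iff 1]
    simp only [e]
    exact (bh_summable (m + 1) y).neg
  rw [hs.tsum_eq_zero_add]
  simp only [e]
  rw [tsum_neg, bh]
  simp

lemma bh_hasDerivAt (m : ℕ) (y : ℝ) : HasDerivAt (bh m) (- bh (m + 1) y) y := by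
  rw [← bh_shift]
  set R : ℝ := |y| + 1 with hR
  have hR0 : 0 ≤ R := by positivity
  have hu : Summable (fun k : ℕ => 1 / (k.factorial : ℝ) * (k * R ^ (k - 1))) := by
    rw [← summable_nat_add_iff 1]
    refine (Real.summable_pow_div_factorial R).congr (fun k => ?_)
    rw [Nat.factorial_succ k]
    have h1 : (k.factorial : ℝ) ≠ 0 := by positivity
    have h3 : (k : ℝ) + 1 ≠ 0 := by positivity
    push_cast
    field_simp
  refine hasDerivAt_tsum_of_isPreconnected (t := Metric.ball 0 R) (y₀ := 0)
    (g := fun k z => (-1 : ℝ) ^ k / ((k.factorial : ℝ) * ((k + m).factorial : ℝ)) * z ^ k)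
    (g' := fun k z => (-1 : ℝ) ^ k / ((k.factorial : ℝ) * ((k + m).factorial : ℝ)) *
      (k * z ^ (k - 1))) hu Metric.isOpen_ball
    (convex_ball _ _).isPreconnected ?_ ?_ ?_ ?_ ?_
  · intro k z _
    exact (hasDerivAt_pow k z).const_mul _
  · intro k z hz
    have hz' : |z| ≤ R := by
      have := Metric.mem_ball.1 hz
      rw [Real.dist_eq, sub_zero] at this
      exact this.le
    rw [Real.norm_eq_abs, abs_mul, abs_mul, abs_pow, Nat.abs_cast]
    gcongr
    exact bh_coeff_le m k
  · simp; positivity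
  · exact bh_summable m 0
  · simp [hR]

lemma bh_rec (m : ℕ) (y : ℝ) :
    y * bh (m + 2) y - (m + 1) * bh (m + 1) y + bh m y = 0 := by
  have h1 := bh_shift (m + 1) y
  have e : y * bh (m + 2) y = ∑' k : ℕ, -(k : ℝ) *
      ((-1 : ℝ) ^ k / ((k.factorial : ℝ) * ((k + (m + 1)).factorial : ℝ)) * y ^ k) := by
    have : bh (m + 2) y = - ∑' k : ℕ, (-1 : ℝ) ^ k / ((k.factorial : ℝ) *
      ((k + (m + 1)).factorial : ℝ)) * (k * y ^ (k - 1)) := by rw [h1]; ring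
    rw [this, ← tsum_neg, ← tsum_mul_left]
    congr 1; ext k
    rcases k with _ | k
    · simp
    · simp only [Nat.add_sub_cancel]; ring
  have s1 := bh_summable m y
  have s2 := (bh_summable (m + 1) y).mul_left ((m : ℝ) + 1)
  have e2 : y * bh (m + 2) y = (m + 1) * bh (m + 1) y - bh m y := by
    rw [e, bh, bh, ← tsum_mul_left, ← s2.tsum_sub s1]
    congr 1; ext k
    have : k + (m + 1) = (k + m) + 1 := by ring
    rw [this, Nat.factorial_succ (k + m)]
    have h1 : (k.factorial : ℝ) ≠ 0 := by positivity
    have h2 : ((k + m).factorial : ℝ) ≠ 0 := by positivity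
    have h3 : (k : ℝ) + m + 1 ≠ 0 := by positivity
    push_cast
    field_simp
    ring
  rw [e2]; ring

lemma besselJ_eq_s1 (n : ℕ) (x : ℝ) : besselJ n x = (x / 2) ^ n * bh n ((x / 2) ^ 2) := by
  rw [besselJ, bh, ← tsum_mul_left]
  congr 1; ext k
  have h1 : (k : ℝ) + n + 1 = ((k + n : ℕ) : ℝ) + 1 := by push_cast; ring
  have h2 : 2 * (k : ℝ) + n = ((2 * k + n : ℕ) : ℝ) := by push_cast; ring
  rw [h1, h2, Real.Gamma_nat_eq_factorial, Real.rpow_natCast, pow_add, pow_mul]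
  ring

/-- `x J_n'(x)` -/
noncomputable def bv (n : ℕ) (x : ℝ) : ℝ :=
  (x / 2) ^ n * (n * bh n ((x / 2) ^ 2) - 2 * (x / 2) ^ 2 * bh (n + 1) ((x / 2) ^ 2))

lemma half_deriv (x : ℝ) : HasDerivAt (fun x : ℝ => x / 2) (1 / 2) x :=
  (hasDerivAt_id x).div_const 2

lemma halfsq_deriv (x : ℝ) : HasDerivAt (fun x : ℝ => (x / 2) ^ 2) (x / 2) x := by
  have := (half_deriv x).pow 2
  refine HasDerivAt.congr_deriv (f := fun x : ℝ => (x / 2) ^ 2) this ?_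
  norm_num
  ring

lemma bhc_deriv (m : ℕ) (x : ℝ) : HasDerivAt (fun x : ℝ => bh m ((x / 2) ^ 2))
    (- bh (m + 1) ((x / 2) ^ 2) * (x / 2)) x :=
  HasDerivAt.comp (h₂ := bh m) x (bh_hasDerivAt m ((x / 2) ^ 2)) (halfsq_deriv x)

lemma J_diff (n : ℕ) (x : ℝ) : DifferentiableAt ℝ (besselJ n) x := by
  have : besselJ n = fun x : ℝ => (x / 2) ^ n * bh n ((x / 2) ^ 2) := funext (besselJ_eq_s1 n)
  rw [this]
  exact (((half_deriv x).pow n).mul (bhc_deriv n x)).differentiableAt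

lemma pow_aux (n : ℕ) (a : ℝ) : a * ((n : ℝ) * a ^ (n - 1)) = n * a ^ n := by
  rcases n with _ | n
  · simp
  · simp only [Nat.add_sub_cancel]; ring

lemma J_bv (n : ℕ) (x : ℝ) : x * deriv (besselJ n) x = bv n x := by
  have : besselJ n = fun x : ℝ => (x / 2) ^ n * bh n ((x / 2) ^ 2) := funext (besselJ_eq_s1 n)
  have h := ((half_deriv x).pow n).mul (bhc_deriv n x)
  have h' := HasDerivAt.deriv (f := fun x : ℝ => (x / 2) ^ n * bh n ((x / 2) ^ 2)) h
  rw [← this] at h'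
  rw [h', bv]
  have := pow_aux n (x / 2)
  simp only [Pi.pow_apply]
  linear_combination (bh n ((x / 2) ^ 2)) * this

lemma bv_deriv_aux (n : ℕ) (x : ℝ) : ∃ d, HasDerivAt (bv n) d x ∧
    x * d = (n ^ 2 - x ^ 2) * besselJ n x := by
  have h := ((half_deriv x).pow n).mul (((bhc_deriv n x).const_mul (n : ℝ)).sub
    (((halfsq_deriv x).const_mul 2).mul (bhc_deriv (n + 1) x)))
  refine ⟨_, h, ?_⟩
  have h1 := pow_aux n (x / 2)
  have h2 := bh_rec n ((x / 2) ^ 2)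
  rw [besselJ_eq_s1]
  simp only [Pi.pow_apply, Pi.sub_apply, Pi.mul_apply]
  linear_combination (n * bh n ((x / 2) ^ 2) - 2 * (x / 2) ^ 2 * bh (n + 1) ((x / 2) ^ 2)) * h1 +
    4 * (x / 2) ^ 2 * (x / 2) ^ n * h2

lemma bv_hasDerivAt (n : ℕ) (x : ℝ) (hx : 0 < x) :
    HasDerivAt (bv n) ((n ^ 2 - x ^ 2) * besselJ n x / x) x := by
  obtain ⟨d, hd, h⟩ := bv_deriv_aux n x
  rw [← h, mul_div_cancel_left₀ _ hx.ne']
  exact hd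

lemma J_hasDerivAt (n : ℕ) (x : ℝ) (hx : 0 < x) : HasDerivAt (besselJ n) (bv n x / x) x := by
  rw [← J_bv, mul_div_cancel_left₀ _ hx.ne']
  exact (J_diff n x).hasDerivAt

lemma bv_cont (n : ℕ) : Continuous (bv n) := by
  rw [continuous_iff_continuousAt]
  intro x
  obtain ⟨d, hd, _⟩ := bv_deriv_aux n x
  exact hd.continuousAt

lemma J_cont (n : ℕ) : Continuous (besselJ n) :=
  continuous_iff_continuousAt.2 fun x => (J_diff n x).continuousAt

lemma bv_zero (n : ℕ) (hn : 1 ≤ n) : bv n 0 = 0 := by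
  rw [← J_bv]; simp

lemma J_zero (n : ℕ) (hn : 1 ≤ n) : besselJ n 0 = 0 := by
  rw [besselJ_eq_s1]; simp; left; omega

lemma J_small (n : ℕ) : ∀ᶠ x in 𝓝[>] (0 : ℝ), 0 < besselJ n x := by
  have hc : ContinuousAt (fun x : ℝ => bh n ((x / 2) ^ 2)) 0 := (bhc_deriv n 0).continuousAt
  have h0 : 0 < bh n ((0 / 2) ^ 2) := by
    have : bh n 0 = 1 / (n.factorial : ℝ) := by
      rw [bh, tsum_eq_single 0]
      · simp
      · intro k hk; simp [hk]
    simp only [zero_div, ne_eq, OfNat.ofNat_ne_zero, not_false_eq_true, zero_pow, this]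
    positivity
  have := hc.eventually (lt_mem_nhds h0)
  filter_upwards [nhdsWithin_le_nhds this, self_mem_nhdsWithin] with x h1 h2
  rw [besselJ_eq_s1]
  have : (0 : ℝ) < x := h2
  positivity

/-- `J_n²` is monotone and nonzero on `(0,n]`, and `J_n J_n'>0` -/
lemma prod_strictMono (n : ℕ) (hn : 1 ≤ n) :
    MonotoneOn (fun x => besselJ n x * bv n x) (Set.Icc 0 n) := by
  apply monotoneOn_of_deriv_nonneg (convex_Icc _ _)
  · exact ((J_cont n).mul (bv_cont n)).continuousOn
  · intro x hx
    rw [interior_Icc] at hx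
    exact ((J_hasDerivAt n x hx.1).mul (bv_hasDerivAt n x hx.1)).differentiableAt.differentiableWithinAt
  · intro x hx
    rw [interior_Icc] at hx
    have hx0 := hx.1
    have := ((J_hasDerivAt n x hx.1).mul (bv_hasDerivAt n x hx.1)).deriv
    change 0 ≤ deriv (besselJ n * bv n) x
    rw [this]
    have h1 : 0 ≤ (n : ℝ) ^ 2 - x ^ 2 := by nlinarith [hx.2]
    have : bv n x / x * bv n x + besselJ n x * ((n ^ 2 - x ^ 2) * besselJ n x / x) =
      ((bv n x) ^ 2 + (n ^ 2 - x ^ 2) * (besselJ n x) ^ 2) / x := by ring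
    rw [this]
    positivity

lemma prod_nonneg' (n : ℕ) (hn : 1 ≤ n) (x : ℝ) (hx : 0 ≤ x) (hxn : x ≤ n) :
    0 ≤ besselJ n x * bv n x := by
  have := prod_strictMono n hn (a := 0) (b := x) ⟨le_rfl, by positivity⟩ ⟨hx, hxn⟩ hx
  simpa [J_zero n hn] using this

lemma sq_hasDerivAt (n : ℕ) (x : ℝ) (hx : 0 < x) :
    HasDerivAt (fun x => besselJ n x ^ 2) (2 * (besselJ n x * bv n x) / x) x := by
  have := (J_hasDerivAt n x hx).pow 2
  refine HasDerivAt.congr_deriv (f := fun x => besselJ n x ^ 2) this ?_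
  norm_num; ring

lemma sq_mono (n : ℕ) (hn : 1 ≤ n) :
    MonotoneOn (fun x => besselJ n x ^ 2) (Set.Icc 0 n) := by
  apply monotoneOn_of_deriv_nonneg (convex_Icc _ _)
  · exact ((J_cont n).pow 2).continuousOn
  · intro x hx
    rw [interior_Icc] at hx
    exact (sq_hasDerivAt n x hx.1).differentiableAt.differentiableWithinAt
  · intro x hx
    rw [interior_Icc] at hx
    rw [(sq_hasDerivAt n x hx.1).deriv]
    have := prod_nonneg' n hn x hx.1.le hx.2.le
    have := hx.1
    positivity

lemma sq_pos' (n : ℕ) (hn : 1 ≤ n) (x : ℝ) (hx : 0 < x) (hxn : x ≤ n) : 0 < besselJ n x ^ 2 := by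
  have h1 : ∀ᶠ y in 𝓝[>] (0 : ℝ), y < x := nhdsWithin_le_nhds (gt_mem_nhds hx)
  obtain ⟨y, ⟨hy1, hy2⟩, hy3⟩ := ((J_small n).and h1).and self_mem_nhdsWithin |>.exists
  have hy0 : (0 : ℝ) < y := hy3
  have := sq_mono n hn (a := y) (b := x) ⟨hy0.le, by linarith⟩ ⟨hx.le, hxn⟩ hy2.le
  simp only at this
  exact lt_of_lt_of_le (by positivity) this

/-- energy -/
lemma energy (n : ℕ) (hn : 1 ≤ n) (x : ℝ) (hx : 0 < x) :
    ((n : ℝ) ^ 2 - x ^ 2) * besselJ n x ^ 2 < bv n x ^ 2 ∨ n < x := by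
  by_cases hxn : (n : ℝ) < x
  · exact Or.inr hxn
  left
  push Not at hxn
  have d : ∀ x, 0 < x → HasDerivAt (fun x => bv n x ^ 2 - ((n : ℝ) ^ 2 - x ^ 2) * besselJ n x ^ 2)
      (2 * x * besselJ n x ^ 2) x := by
    intro x hx
    have h := ((bv_hasDerivAt n x hx).pow 2).sub
      ((((hasDerivAt_id x).pow 2).const_sub ((n : ℝ) ^ 2)).mul (sq_hasDerivAt n x hx))
    refine HasDerivAt.congr_deriv
      (f := fun x => bv n x ^ 2 - ((n : ℝ) ^ 2 - x ^ 2) * besselJ n x ^ 2) h ?_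
    simp only [Pi.pow_apply, id]
    norm_num
    field_simp
    ring
  have : StrictMonoOn (fun x => bv n x ^ 2 - ((n : ℝ) ^ 2 - x ^ 2) * besselJ n x ^ 2)
      (Set.Icc 0 n) := by
    apply strictMonoOn_of_deriv_pos (convex_Icc _ _)
    · exact (((bv_cont n).pow 2).sub ((continuous_const.sub (continuous_id.pow 2)).mul
        ((J_cont n).pow 2))).continuousOn
    · intro x hx
      rw [interior_Icc] at hx
      rw [(d x hx.1).deriv]
      have := sq_pos' n hn x hx.1 hx.2.le
      have := hx.1
      positivity
  have := this (a := 0) (b := x) ⟨le_rfl, by positivity⟩ ⟨hx.le, hxn⟩ hx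
  simp [J_zero n hn, bv_zero n hn] at this
  exact this

lemma crit_gt (n : ℕ) (hn : 1 ≤ n) (x : ℝ) (hx : 0 < x) (h : deriv (besselJ n) x = 0) : n < x := by
  rcases energy n hn x hx with h1 | h1
  · by_contra hc
    push Not at hc
    rw [← J_bv, h] at h1
    have : 0 ≤ (n : ℝ) ^ 2 - x ^ 2 := by nlinarith
    nlinarith [mul_nonneg this (sq_nonneg (besselJ n x))]
  · exact h1

/-- growth -/
lemma growth (n : ℕ) (hn : 1 ≤ n) (a b w : ℝ) (ha : 0 < a) (hab : a ≤ b) (hb : b ≤ n)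
    (hw : 0 ≤ w) (hwb : w ^ 2 ≤ (n : ℝ) ^ 2 - b ^ 2) :
    |besselJ n a| ≤ |besselJ n b| * Real.exp (-(w / n * (b - a))) := by
  have hn0 : (0 : ℝ) < n := by positivity
  have key : ∀ x, 0 < x → x ≤ b → 2 * (w / n) * besselJ n x ^ 2 ≤ 2 * (besselJ n x * bv n x) / x := by
    intro x hx hxb
    have e := (energy n hn x hx).resolve_right (by linarith)
    have hG := prod_nonneg' n hn x hx.le (hxb.trans hb)
    have hw2 : w ^ 2 ≤ (n : ℝ) ^ 2 - x ^ 2 := by nlinarith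
    have h1 : w * besselJ n x ^ 2 ≤ besselJ n x * bv n x := by
      apply abs_le_of_sq_le_sq' _ hG |>.2
      have : w ^ 2 * besselJ n x ^ 2 ≤ bv n x ^ 2 := by
        nlinarith [mul_le_mul_of_nonneg_right hw2 (sq_nonneg (besselJ n x))]
      nlinarith [mul_le_mul_of_nonneg_left this (sq_nonneg (besselJ n x))]
    have h2 : w / n * besselJ n x ^ 2 ≤ besselJ n x * bv n x / x := by
      calc w / n * besselJ n x ^ 2 = w * besselJ n x ^ 2 / n := by ring
        _ ≤ w * besselJ n x ^ 2 / x :=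
          div_le_div_of_nonneg_left (by positivity) hx (hxb.trans hb)
        _ ≤ _ := div_le_div_of_nonneg_right h1 hx.le
    calc _ = 2 * (w / n * besselJ n x ^ 2) := by ring
      _ ≤ 2 * (besselJ n x * bv n x / x) := by linarith
      _ = _ := by ring
  have d : ∀ x, 0 < x → HasDerivAt (fun x => besselJ n x ^ 2 * Real.exp (-(2 * (w / n) * x)))
      (2 * (besselJ n x * bv n x) / x * Real.exp (-(2 * (w / n) * x)) +
        besselJ n x ^ 2 * (Real.exp (-(2 * (w / n) * x)) * -(2 * (w / n)))) x := by
    intro x hx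
    refine (sq_hasDerivAt n x hx).mul ?_
    have := (((hasDerivAt_id x).const_mul (2 * (w / n))).neg).exp
    simpa using this
  have mono : MonotoneOn (fun x => besselJ n x ^ 2 * Real.exp (-(2 * (w / n) * x))) (Set.Icc a b) := by
    apply monotoneOn_of_deriv_nonneg (convex_Icc _ _)
    · exact fun x hx => (d x (by linarith [hx.1])).continuousAt.continuousWithinAt
    · intro x hx
      rw [interior_Icc] at hx
      exact (d x (by linarith [hx.1])).differentiableAt.differentiableWithinAt
    · intro x hx
      rw [interior_Icc] at hx
      have hx0 : 0 < x := by linarith [hx.1]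
      rw [(d x hx0).deriv]
      have := key x hx0 hx.2.le
      nlinarith [mul_le_mul_of_nonneg_right this (Real.exp_pos (-(2 * (w / n) * x))).le]
  have h := mono (a := a) (b := b) ⟨le_rfl, hab⟩ ⟨hab, le_rfl⟩ hab
  simp only at h
  apply abs_le_of_sq_le_sq' _ (by positivity) |>.2
  rw [mul_pow, sq_abs, sq_abs, ← Real.exp_nat_mul]
  have e1 : Real.exp ((2 : ℕ) * (-(w / n * (b - a)))) =
      Real.exp (-(2 * (w / n) * b)) * Real.exp (2 * (w / n) * a) := by
    rw [← Real.exp_add]; congr 1; push_cast; ring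
  have e2 : Real.exp (-(2 * (w / n) * a)) * Real.exp (2 * (w / n) * a) = 1 := by
    rw [← Real.exp_add]; simp
  rw [e1]
  calc besselJ n a ^ 2 = besselJ n a ^ 2 * Real.exp (-(2 * (w / n) * a)) * Real.exp (2 * (w / n) * a) := by
        rw [mul_assoc, e2, mul_one]
    _ ≤ _ := by rw [← mul_assoc]; exact mul_le_mul_of_nonneg_right h (Real.exp_pos _).le

set_option maxHeartbeats 2000000 in
lemma ratio_bound (p : ℝ) (hp : 1 ≤ p) (n : ℕ) (hn : 2 ≤ n) (α : ℝ) (hα : n < α) :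
    diskRatio p n α <
      5 * (n : ℝ) ^ ((1 : ℝ) / 3 + 2 / (3 * p)) * (2 : ℝ) ^ (-(n : ℝ) ^ ((1 : ℝ) / 3) / 3) := by
  have hn1 : 1 ≤ n := by omega
  have hnR : (1 : ℝ) < n := by exact_mod_cast (by omega : 1 < n)
  have hn0 : (0 : ℝ) ≤ n := by positivity
  have hp0 : 0 < p := by linarith
  set s : ℝ := (n : ℝ) ^ ((1 : ℝ) / 3) with hs
  have hs1 : 1 < s := Real.one_lt_rpow hnR (by norm_num)
  have hs3 : s ^ 3 = n := by
    rw [hs, ← Real.rpow_natCast, ← Real.rpow_mul hn0]; norm_num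
  have hs2 : (n : ℝ) ^ ((2 : ℝ) / 3) = s ^ 2 := by
    rw [hs, ← Real.rpow_natCast, ← Real.rpow_mul hn0]; norm_num
  have hpow : (n : ℝ) ^ ((1 : ℝ) / 3 + 2 / (3 * p)) = s ^ (1 + 2 / p) := by
    rw [hs, ← Real.rpow_mul hn0]; congr 1; field_simp
  have hs23 : s ^ 2 < s ^ 3 := by nlinarith [sq_nonneg s]
  have hd : dseq n = s ^ 3 - s ^ 2 := by rw [dseq, hs2, hs3]
  set d : ℝ := dseq n with hddef
  set m : ℝ := s ^ 3 - s ^ 2 / 2 with hm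
  have hs2pos : 0 < s ^ 2 := by positivity
  have hd0 : 0 < d := by linarith
  have hdm : d ≤ m := by linarith
  have hmn : m ≤ n := by rw [← hs3]; linarith
  have hgr := growth n hn1 d m (2 / 3 * s ^ 2) hd0 hdm hmn (by positivity) (by
    rw [← hs3, hm]
    have : s ^ 4 ≤ s ^ 5 := by nlinarith [pow_pos (by linarith : 0 < s) 4]
    have h4 : 0 < s ^ 4 := by positivity
    nlinarith)
  have hexp : -(2 / 3 * s ^ 2 / n * (m - d)) = -(s / 3) := by
    rw [← hs3, hm, hd]
    have : s ≠ 0 := by linarith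
    field_simp
    ring
  rw [hexp] at hgr
  set r := Real.exp (-(s / 3)) with hr
  set A := |besselJ n d| with hA
  set B := |besselJ n m| with hB
  have hA0 : 0 ≤ A := abs_nonneg _
  have hB0 : 0 < B := by
    have := sq_pos' n hn1 m (by linarith) hmn
    rw [hB, abs_pos]
    intro h0
    rw [h0] at this
    simp at this
  have hr0 : 0 < r := Real.exp_pos _
  have hc : Continuous (fun z => z * |besselJ n z| ^ p) :=
    continuous_id.mul ((J_cont n).abs.rpow_const (fun _ => Or.inr hp0.le))
  have habs : ∀ x y : ℝ, 0 ≤ x → x ≤ y → y ≤ n → |besselJ n x| ≤ |besselJ n y| := by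
    intro x y hx hxy hy
    exact sq_le_sq.1 (sq_mono n hn1 (a := x) (b := y) ⟨hx, hxy.trans hy⟩ ⟨hx.trans hxy, hy⟩ hxy)
  have num : (∫ z in (0 : ℝ)..d, z * |besselJ n z| ^ p) ≤ s ^ 6 * A ^ p := by
    calc (∫ z in (0 : ℝ)..d, z * |besselJ n z| ^ p) ≤ ∫ z in (0 : ℝ)..d, s ^ 3 * A ^ p := by
          apply intervalIntegral.integral_mono_on hd0.le (hc.intervalIntegrable _ _)
            (continuous_const.intervalIntegrable _ _)
          intro z hz
          have := habs z d hz.1 hz.2 (hdm.trans hmn)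
          have h1 : z ≤ s ^ 3 := by linarith [hz.2]
          have h2 := hz.1
          gcongr
      _ = d * (s ^ 3 * A ^ p) := by
          rw [intervalIntegral.integral_const, smul_eq_mul, sub_zero]
      _ ≤ s ^ 3 * (s ^ 3 * A ^ p) := by
          have : 0 ≤ A ^ p := by positivity
          gcongr
          linarith
      _ = _ := by ring
  have den : s ^ 5 / 4 * B ^ p ≤ ∫ z in (0 : ℝ)..α, z * |besselJ n z| ^ p := by
    calc s ^ 5 / 4 * B ^ p = (s ^ 2 / 2) * (s ^ 3 / 2 * B ^ p) := by ring
      _ = ∫ z in m..(n : ℝ), s ^ 3 / 2 * B ^ p := by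
          rw [intervalIntegral.integral_const, ← hs3, hm, smul_eq_mul]; ring
      _ ≤ ∫ z in m..(n : ℝ), z * |besselJ n z| ^ p := by
          apply intervalIntegral.integral_mono_on hmn (continuous_const.intervalIntegrable _ _)
            (hc.intervalIntegrable _ _)
          intro z hz
          have := habs m z (by linarith) hz.1 hz.2
          have h1 : s ^ 3 / 2 ≤ z := by linarith [hz.1]
          have h3 : 0 < s ^ 3 := by positivity
          gcongr
          linarith
      _ ≤ _ := by
          apply intervalIntegral.integral_mono_interval (by linarith) hmn hα.le
          · refine (ae_restrict_iff' measurableSet_Ioc).2 (Eventually.of_forall ?_)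
            intro z hz
            have := hz.1
            simp only [Pi.zero_apply]
            positivity
          · exact hc.intervalIntegrable _ _
  have hs0 : 0 < s := by linarith
  have hratio : (∫ z in (0 : ℝ)..d, z * |besselJ n z| ^ p) /
      (∫ z in (0 : ℝ)..α, z * |besselJ n z| ^ p) ≤ 4 * s * r ^ p := by
    have hden0 : 0 < s ^ 5 / 4 * B ^ p := by positivity
    rw [div_le_iff₀ (hden0.trans_le den)]
    calc _ ≤ s ^ 6 * A ^ p := num
      _ ≤ s ^ 6 * (B * r) ^ p := by gcongr
      _ = 4 * s * r ^ p * (s ^ 5 / 4 * B ^ p) := by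
          rw [Real.mul_rpow hB0.le hr0.le]; ring
      _ ≤ _ := by gcongr
  have hnum0 : 0 ≤ (∫ z in (0 : ℝ)..d, z * |besselJ n z| ^ p) :=
    intervalIntegral.integral_nonneg hd0.le (fun z hz => by have := hz.1; positivity)
  have hden0 : 0 ≤ (∫ z in (0 : ℝ)..α, z * |besselJ n z| ^ p) :=
    intervalIntegral.integral_nonneg (by linarith) (fun z hz => by have := hz.1; positivity)
  have h1p : 1 / p ≤ 1 := by rw [div_le_one hp0]; exact hp
  have h1p0 : 0 < 1 / p := by positivity
  have h4 : (4 : ℝ) ^ (1 / p) ≤ 4 := by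
    calc (4 : ℝ) ^ (1 / p) ≤ 4 ^ (1 : ℝ) := Real.rpow_le_rpow_of_exponent_le (by norm_num) h1p
      _ = 4 := by simp
  have hss : s ^ (1 / p) ≤ s ^ (1 + 2 / p) := by
    apply Real.rpow_le_rpow_of_exponent_le hs1.le
    have : 2 / p = 2 * (1 / p) := by ring
    linarith
  have hr2 : r ≤ (2 : ℝ) ^ (-s / 3) := by
    rw [hr, Real.rpow_def_of_pos (by norm_num)]
    apply Real.exp_le_exp.2
    have : Real.log 2 < 1 := by linarith [Real.log_two_lt_d9]
    nlinarith
  rw [hpow]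
  calc diskRatio p n α ≤ (4 * s * r ^ p) ^ (1 / p) := by
        rw [diskRatio]
        exact Real.rpow_le_rpow (by positivity) hratio h1p0.le
    _ = 4 ^ (1 / p) * s ^ (1 / p) * r := by
        rw [Real.mul_rpow (by positivity) (by positivity), Real.mul_rpow (by norm_num) hs0.le,
          ← Real.rpow_mul hr0.le]
        congr 1
        rw [mul_one_div_cancel hp0.ne', Real.rpow_one]
    _ ≤ 4 * s ^ (1 + 2 / p) * (2 : ℝ) ^ (-s / 3) := by gcongr
    _ < 5 * s ^ (1 + 2 / p) * (2 : ℝ) ^ (-s / 3) := by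
        have : 0 < s ^ (1 + 2 / p) * (2 : ℝ) ^ (-s / 3) := by positivity
        nlinarith

lemma g_deriv (n : ℕ) (t : ℝ) :
    HasDerivAt (fun t => besselJ n (Real.exp t)) (bv n (Real.exp t)) t := by
  have := HasDerivAt.comp (h₂ := besselJ n) t (J_hasDerivAt n (Real.exp t) (Real.exp_pos t))
    (Real.hasDerivAt_exp t)
  rw [div_mul_cancel₀ _ (Real.exp_pos t).ne'] at this
  exact this

lemma g_deriv2 (n : ℕ) (t : ℝ) :
    HasDerivAt (fun t => bv n (Real.exp t))
      ((n ^ 2 - Real.exp t ^ 2) * besselJ n (Real.exp t)) t := by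
  have := HasDerivAt.comp (h₂ := bv n) t (bv_hasDerivAt n (Real.exp t) (Real.exp_pos t))
    (Real.hasDerivAt_exp t)
  rw [div_mul_cancel₀ _ (Real.exp_pos t).ne'] at this
  exact this

lemma sturm (n : ℕ) (ω a : ℝ) (hω : 0 < ω)
    (h : ∀ t, a ≤ t → ω ^ 2 ≤ Real.exp t ^ 2 - n ^ 2) :
    ∃ t ∈ Set.Icc a (a + π / ω), besselJ n (Real.exp t) = 0 := by
  have hab : a ≤ a + π / ω := by have := Real.pi_pos; have : 0 < π / ω := by positivity
                                 linarith
  have key : ∀ σ : ℝ, 0 < σ * besselJ n (Real.exp a) →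
      ∃ t ∈ Set.Icc a (a + π / ω), besselJ n (Real.exp t) = 0 := by
    intro σ hσ
    have hσ0 : σ ≠ 0 := by rintro rfl; simp at hσ
    by_contra hcon
    push Not at hcon
    have pos : ∀ t ∈ Set.Icc a (a + π / ω), 0 < σ * besselJ n (Real.exp t) := by
      intro t ht
      by_contra hneg
      push Not at hneg
      have hcont : ContinuousOn (fun t => σ * besselJ n (Real.exp t)) (Set.Icc a t) :=
        (continuous_const.mul ((J_cont n).comp Real.continuous_exp)).continuousOn
      obtain ⟨u, hu, hu0⟩ := intermediate_value_Icc' ht.1 hcont ⟨hneg, hσ.le⟩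
      simp only at hu0
      exact hcon u ⟨hu.1, hu.2.trans ht.2⟩ ((mul_eq_zero.1 hu0).resolve_left hσ0)
    let W : ℝ → ℝ := fun t => σ * (bv n (Real.exp t) * Real.sin (ω * (t - a)) -
      besselJ n (Real.exp t) * (ω * Real.cos (ω * (t - a))))
    have hW : ∀ t, HasDerivAt W (-(σ * besselJ n (Real.exp t)) *
        ((Real.exp t ^ 2 - n ^ 2 - ω ^ 2) * Real.sin (ω * (t - a)))) t := by
      intro t
      have hl : HasDerivAt (fun t => ω * (t - a)) ω t := by
        simpa using ((hasDerivAt_id t).sub_const a).const_mul ω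
      have := (((g_deriv2 n t).mul hl.sin).sub
        ((g_deriv n t).mul (hl.cos.const_mul ω))).const_mul σ
      refine HasDerivAt.congr_deriv (f := W) this ?_
      ring
    have anti : AntitoneOn W (Set.Icc a (a + π / ω)) := by
      apply antitoneOn_of_deriv_nonpos (convex_Icc _ _)
      · exact fun t _ => (hW t).continuousAt.continuousWithinAt
      · exact fun t _ => (hW t).differentiableAt.differentiableWithinAt
      · intro t ht
        rw [interior_Icc] at ht
        rw [(hW t).deriv]
        have h1 := pos t ⟨ht.1.le, ht.2.le⟩
        have h2 := h t ht.1.le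
        have h3 : 0 ≤ Real.sin (ω * (t - a)) := by
          apply Real.sin_nonneg_of_nonneg_of_le_pi
          · have := ht.1
            have : 0 ≤ t - a := by linarith
            positivity
          · have : t - a ≤ π / ω := by linarith [ht.2]
            rw [le_div_iff₀ hω] at this
            linarith
        have h4 := mul_nonneg (by linarith : 0 ≤ Real.exp t ^ 2 - n ^ 2 - ω ^ 2) h3
        nlinarith [mul_nonneg h1.le h4]
    have hfin := anti (a := a) (b := a + π / ω) ⟨le_rfl, hab⟩ ⟨hab, le_rfl⟩ hab
    have e : ω * (a + π / ω - a) = π := by field_simp; ring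
    simp only [W, e, sub_self, mul_zero, Real.sin_zero, Real.cos_zero, Real.sin_pi, Real.cos_pi] at hfin
    have h1 := pos (a + π / ω) ⟨hab, le_rfl⟩
    nlinarith [mul_pos hσ hω, mul_pos h1 hω]
  rcases lt_trichotomy (besselJ n (Real.exp a)) 0 with h0 | h0 | h0
  · exact key (-1) (by linarith)
  · exact ⟨a, ⟨le_rfl, hab⟩, h0⟩
  · exact key 1 (by linarith)

lemma crit_seq (n : ℕ) (δ : ℝ) (hn : 1 ≤ n) (hδ : 0 < δ) :
    ∃ c : ℕ → ℝ, StrictMono c ∧ ∀ i, 0 < c i ∧ deriv (besselJ n) (c i) = 0 ∧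
      c i ≤ (1 + δ) * n * Real.exp ((2 * i + 3) * (π / (δ * n))) := by
  have hn0 : (0 : ℝ) < n := by positivity
  set L := π / (δ * n) with hL
  have hL0 : 0 < L := by have := Real.pi_pos; positivity
  set a := Real.log ((1 + δ) * n) with ha
  have hea : Real.exp a = (1 + δ) * n := Real.exp_log (by positivity)
  have hz : ∀ i : ℕ, ∃ t ∈ Set.Icc (a + 2 * i * L) (a + 2 * i * L + L),
      besselJ n (Real.exp t) = 0 := by
    intro i
    refine sturm n (δ * n) (a + 2 * i * L) (by positivity) ?_
    intro t ht
    have h1 : (1 + δ) * n ≤ Real.exp t := by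
      rw [← hea]
      apply Real.exp_le_exp.2
      have : 0 ≤ 2 * i * L := by positivity
      linarith
    have h2 : ((1 + δ) * n) ^ 2 ≤ Real.exp t ^ 2 := by gcongr
    have : 0 < δ * n ^ 2 := by positivity
    nlinarith
  choose z hz1 hz2 using hz
  have hlt : ∀ i, z i < z (i + 1) := by
    intro i
    have h1 := (hz1 i).2
    have h2 := (hz1 (i + 1)).1
    push_cast at h2
    nlinarith
  have hr : ∀ i, ∃ c ∈ Set.Ioo (Real.exp (z i)) (Real.exp (z (i + 1))),
      deriv (besselJ n) c = 0 := by
    intro i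
    exact exists_deriv_eq_zero (Real.exp_lt_exp.2 (hlt i)) (J_cont n).continuousOn
      (by rw [hz2, hz2])
  choose c hc1 hc2 using hr
  refine ⟨c, strictMono_nat_of_lt_succ fun i => (hc1 i).2.trans (hc1 (i + 1)).1, fun i =>
    ⟨(Real.exp_pos _).trans (hc1 i).1, hc2 i, ?_⟩⟩
  rw [← hea, ← Real.exp_add]
  refine (hc1 i).2.le.trans (Real.exp_le_exp.2 ?_)
  have := (hz1 (i + 1)).2
  push_cast at this
  nlinarith

lemma j_le (n : ℕ) (hn : 1 ≤ n) (j : ℕ → ℝ)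
    (hmono : ∀ (k l : ℕ), 1 ≤ k → k < l → j k < j l)
    (hsurj : ∀ (x : ℝ), 0 < x → deriv (besselJ n) x = 0 → ∃ k, 1 ≤ k ∧ j k = x)
    (δ : ℝ) (hδ : 0 < δ) (k : ℕ) :
    j (k + 1) ≤ (1 + δ) * n * Real.exp ((2 * k + 3) * (π / (δ * n))) := by
  obtain ⟨c, hc, h⟩ := crit_seq n δ hn hδ
  choose φ hφ1 hφ2 using fun i => hsurj (c i) (h i).1 (h i).2.1
  have hφ : StrictMono φ := by
    intro i l hil
    by_contra hle
    push Not at hle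
    have h1 : j (φ l) ≤ j (φ i) := by
      rcases hle.eq_or_lt with e | e
      · rw [e]
      · exact (hmono _ _ (hφ1 l) e).le
    rw [hφ2, hφ2] at h1
    exact absurd (hc hil) (not_lt.2 h1)
  have hk : k + 1 ≤ φ k := by
    have h0 := hφ1 0
    have : ∀ k, k + 1 ≤ φ k := by
      intro k
      induction k with
      | zero => exact h0
      | succ k ih => have := hφ (Nat.lt_add_one k); omega
    exact this k
  have : j (k + 1) ≤ j (φ k) := by
    rcases hk.eq_or_lt with e | e
    · rw [← e]
    · exact (hmono _ _ (by omega) e).le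
  rw [hφ2] at this
  exact this.trans (h k).2.2

lemma ratio_nonneg (p : ℝ) (n : ℕ) (hn : 1 ≤ n) (α : ℝ) (hα : 0 < α) : 0 ≤ diskRatio p n α := by
  have hd : 0 ≤ dseq n := by
    have h1 : (1 : ℝ) ≤ n := by exact_mod_cast hn
    rw [dseq, sub_nonneg]
    calc (n : ℝ) ^ ((2 : ℝ) / 3) ≤ (n : ℝ) ^ (1 : ℝ) :=
          Real.rpow_le_rpow_of_exponent_le h1 (by norm_num)
      _ = n := by simp
  have h1 : 0 ≤ (∫ z in (0 : ℝ)..dseq n, z * |besselJ n z| ^ p) :=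
    intervalIntegral.integral_nonneg hd (fun z hz => by have := hz.1; positivity)
  have h2 : 0 ≤ (∫ z in (0 : ℝ)..α, z * |besselJ n z| ^ p) :=
    intervalIntegral.integral_nonneg hα.le (fun z hz => by have := hz.1; positivity)
  rw [diskRatio]
  positivity

lemma bound_tendsto (q : ℝ) : Tendsto (fun n : ℕ =>
    5 * (n : ℝ) ^ q * (2 : ℝ) ^ (-(n : ℝ) ^ ((1 : ℝ) / 3) / 3)) atTop (𝓝 0) := by
  have h1 : Tendsto (fun n : ℕ => (n : ℝ) ^ ((1 : ℝ) / 3)) atTop atTop :=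
    (tendsto_rpow_atTop (by norm_num)).comp tendsto_natCast_atTop_atTop
  have hb : 0 < Real.log 2 / 3 := by have := Real.log_pos (by norm_num : (1 : ℝ) < 2); positivity
  have h2 := ((tendsto_rpow_mul_exp_neg_mul_atTop_nhds_zero (3 * q) (Real.log 2 / 3) hb).comp
    h1).const_mul 5
  rw [mul_zero] at h2
  refine h2.congr (fun n => ?_)
  simp only [Function.comp]
  rw [← Real.rpow_mul (by positivity), Real.rpow_def_of_pos (by norm_num : (0 : ℝ) < 2), mul_assoc]
  congr 2
  · congr 1; ring
  · congr 1; ring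

lemma tendsto_j (j : ℕ → ℝ) (k : ℕ) (h1 : ∀ n : ℕ, 1 ≤ n → (n : ℝ) < j n)
    (h2 : ∀ n : ℕ, 1 ≤ n → ∀ δ : ℝ, 0 < δ →
      j n ≤ (1 + δ) * n * Real.exp ((2 * k + 3) * (π / (δ * n)))) :
    Tendsto (fun n : ℕ => (dseq n / j n) ^ 2) atTop (𝓝 1) := by
  have hr : ∀ a : ℝ, 0 < a → Tendsto (fun n : ℕ => (n : ℝ) ^ (-a)) atTop (𝓝 0) := fun a ha =>
    (tendsto_rpow_neg_atTop ha).comp tendsto_natCast_atTop_atTop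
  have hj : Tendsto (fun n : ℕ => j n / n) atTop (𝓝 1) := by
    have hu : Tendsto (fun n : ℕ => (1 + (n : ℝ) ^ (-(1 / 2 : ℝ))) *
        Real.exp ((2 * k + 3) * (π * (n : ℝ) ^ (-(1 / 2 : ℝ))))) atTop (𝓝 1) := by
      have := hr (1 / 2) (by norm_num)
      have h3 := (this.const_add 1).mul
        ((Real.continuous_exp.tendsto _).comp ((this.const_mul π).const_mul (2 * (k : ℝ) + 3)))
      simpa using h3
    refine tendsto_of_tendsto_of_tendsto_of_le_of_le' tendsto_const_nhds hu ?_ ?_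
    · filter_upwards [eventually_ge_atTop 1] with n hn
      have : (0 : ℝ) < n := by positivity
      rw [le_div_iff₀ this]
      linarith [h1 n hn]
    · filter_upwards [eventually_ge_atTop 1] with n hn
      have hn0 : (0 : ℝ) < n := by positivity
      rw [div_le_iff₀ hn0]
      have := h2 n hn ((n : ℝ) ^ (-(1 / 2 : ℝ))) (by positivity)
      have e : (n : ℝ) ^ (-(1 / 2 : ℝ)) * n = ((n : ℝ) ^ (-(1 / 2 : ℝ)))⁻¹ := by
        nth_rewrite 2 [← Real.rpow_one (n : ℝ)]
        rw [← Real.rpow_add hn0, ← Real.rpow_neg hn0.le]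
        norm_num
      rw [e, div_inv_eq_mul] at this
      linarith
  have hd : Tendsto (fun n : ℕ => dseq n / n) atTop (𝓝 1) := by
    have := (hr (1 / 3) (by norm_num)).const_sub 1
    rw [sub_zero] at this
    refine this.congr' ?_
    filter_upwards [eventually_ge_atTop 1] with n hn
    have hn0 : (0 : ℝ) < n := by positivity
    rw [dseq, sub_div, div_self hn0.ne']
    congr 1
    nth_rewrite 3 [← Real.rpow_one (n : ℝ)]
    rw [← Real.rpow_sub hn0]
    norm_num
  have := (hd.div hj one_ne_zero).pow 2
  simp only [div_one, one_pow] at this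
  refine this.congr' ?_
  filter_upwards [eventually_ge_atTop 1] with n hn
  have hn0 : (n : ℝ) ≠ 0 := by positivity
  simp only [Pi.div_apply]
  rw [div_div_div_cancel_right₀ hn0]

theorem whispering_gallery_disk_neumann
    (p : ℝ) (hp : 1 ≤ p)
    (j' : ℕ → ℕ → ℝ)
    (hj'_pos : ∀ (n k : ℕ), 1 ≤ k → 0 < j' n k)
    (hj'_zero : ∀ (n k : ℕ), 1 ≤ k → deriv (besselJ n) (j' n k) = 0)
    (hj'_mono : ∀ (n k l : ℕ), 1 ≤ k → k < l → j' n k < j' n l)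
    (hj'_surj : ∀ (n : ℕ) (x : ℝ), 0 < x → deriv (besselJ n) x = 0 → ∃ k, 1 ≤ k ∧ j' n k = x) :
    (∃ C : ℝ, 0 < C ∧ ∀ᶠ n : ℕ in atTop, ∀ α : ℝ, 0 < α → deriv (besselJ n) α = 0 →
        diskRatio p n α <
          C * (n : ℝ) ^ ((1 : ℝ) / 3 + 2 / (3 * p)) * (2 : ℝ) ^ (-(n : ℝ) ^ ((1 : ℝ) / 3) / 3))
    ∧ (∀ k : ℕ, 1 ≤ k →
        Tendsto (fun n : ℕ => diskRatio p n (j' n k)) atTop (𝓝 0)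
        ∧ Tendsto (fun n : ℕ => (dseq n / j' n k) ^ 2) atTop (𝓝 1)) := by

  refine ⟨⟨5, by norm_num, ?_⟩, ?_⟩
  · filter_upwards [eventually_ge_atTop 2] with n hn α hα h0
    exact ratio_bound p hp n hn α (crit_gt n (by omega) α hα h0)
  · intro k hk
    have hgt : ∀ n : ℕ, 1 ≤ n → (n : ℝ) < j' n k := fun n hn =>
      crit_gt n hn _ (hj'_pos n k hk) (hj'_zero n k hk)
    refine ⟨?_, ?_⟩
    · refine tendsto_of_tendsto_of_tendsto_of_le_of_le' tendsto_const_nhds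
        (bound_tendsto ((1 : ℝ) / 3 + 2 / (3 * p))) ?_ ?_
      · filter_upwards [eventually_ge_atTop 1] with n hn
        exact ratio_nonneg p n hn _ (hj'_pos n k hk)
      · filter_upwards [eventually_ge_atTop 2] with n hn
        exact (ratio_bound p hp n hn _ (hgt n (by omega))).le
    · obtain ⟨k, rfl⟩ : ∃ l, k = l + 1 := ⟨k - 1, by omega⟩
      exact tendsto_j (fun n => j' n (k + 1)) k hgt (fun n hn δ hδ =>
        j_le n hn (j' n) (hj'_mono n) (hj'_surj n) δ hδ k)
end

section
/- Fix a real p ≥ 1 and set s_n = (n + 1/2) − (n + 1/2)^{2/3} for integers n ≥ 1. There exists a constant C̃_p > 0 depending only on p such that for every sufficiently large integer n and every positive zero α of the derivative j_n′ of the spherical Bessel function, one has ( ∫_0^{s_n} z² |j_n(z)|^p dz / ∫_0^{α} z² |j_n(z)|^p dz )^{1/p} < C̃_p · (n + 1/2)^{1/3 + 2/(3p)} · exp(−(1/3)(n + 1/2)^{1/3}). Moreover, for each fixed k ≥ 1, this quantity with α = γ′_{n,k} tends to 0 as n → ∞. (This is the whispering-gallery localization estimate for the Neumann Laplacian eigenfunctions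 of a ball.) -/
open Real MeasureTheory Filter Topology

/-- The spherical Bessel function `j_n(x) = √(π/(2x)) J_{n+1/2}(x)`. -/
noncomputable def sbesselJ (n : ℕ) (x : ℝ) : ℝ :=
  Real.sqrt (π / (2 * x)) * besselJ ((n : ℝ) + 1 / 2) x

/-- `s_n = (n + 1/2) - (n + 1/2)^{2/3}`. -/
noncomputable def sseq (n : ℕ) : ℝ := ((n : ℝ) + 1 / 2) - ((n : ℝ) + 1 / 2) ^ ((2 : ℝ) / 3)

/-- The ratio `( ∫_0^{s_n} z² |j_n(z)|^p dz / ∫_0^α z² |j_n(z)|^p dz )^{1/p}`. -/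
noncomputable def ballRatio (p : ℝ) (n : ℕ) (α : ℝ) : ℝ :=
  ((∫ z in (0 : ℝ)..sseq n, z ^ 2 * |sbesselJ n z| ^ p) /
    (∫ z in (0 : ℝ)..α, z ^ 2 * |sbesselJ n z| ^ p)) ^ (1 / p)


noncomputable def cF (n k : ℕ) : ℝ := (-1 : ℝ) ^ k / ((k.factorial : ℝ) * Real.Gamma ((k : ℝ) + n + 3/2))
noncomputable def FF (n : ℕ) (y : ℝ) : ℝ := ∑' k : ℕ, cF n k * y ^ k

lemma one_le_Gamma_aux (n k : ℕ) (hn : 1 ≤ n) : 1 ≤ Real.Gamma ((k : ℝ) + n + 3/2) := by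
  have h1 : (1:ℝ) ≤ n := by exact_mod_cast hn
  have h2 : (0:ℝ) ≤ k := by positivity
  have := Real.Gamma_strictMonoOn_Ici.monotoneOn (a := 2) (b := (k : ℝ) + n + 3/2) (by simp) (by simp; linarith) (by linarith)
  rwa [Real.Gamma_two] at this

lemma abs_cF_le (n k : ℕ) (hn : 1 ≤ n) : |cF n k| ≤ 1 / (k.factorial : ℝ) := by
  have h := one_le_Gamma_aux n k hn
  have hk : (0:ℝ) < k.factorial := by positivity
  unfold cF
  rw [abs_div, abs_pow, abs_neg, abs_one, one_pow, abs_of_pos (by positivity)]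
  apply one_div_le_one_div_of_le hk
  nlinarith

lemma summable_FF (n : ℕ) (hn : 1 ≤ n) (y : ℝ) : Summable (fun k : ℕ => cF n k * y ^ k) := by
  refine Summable.of_norm_bounded (Real.summable_pow_div_factorial |y|) ?_
  intro k
  rw [Real.norm_eq_abs, abs_mul, abs_pow]
  have := mul_le_mul_of_nonneg_right (abs_cF_le n k hn) (pow_nonneg (abs_nonneg y) k)
  calc _ ≤ _ := this
    _ = _ := by ring

lemma cF_succ (n k : ℕ) : cF n (k+1) * ((k:ℝ)+1) = - cF (n+1) k := by
  unfold cF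
  have e : ((k+1:ℕ):ℝ) + n + 3/2 = (k:ℝ) + (n+1:ℕ) + 3/2 := by push_cast; ring
  rw [e, Nat.factorial_succ, pow_succ]
  have hk : (k.factorial:ℝ) ≠ 0 := by positivity
  have hk1 : ((k:ℝ)+1) ≠ 0 := by positivity
  have hG : Real.Gamma ((k:ℝ) + (n+1:ℕ) + 3/2) ≠ 0 := (Real.Gamma_pos_of_pos (by positivity)).ne'
  push_cast at *
  field_simp

lemma cF_eq (n k : ℕ) : cF n k = ((k:ℝ) + n + 3/2) * cF (n+1) k := by
  unfold cF
  have e : (k:ℝ) + (n+1:ℕ) + 3/2 = ((k:ℝ) + n + 3/2) + 1 := by push_cast; ring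
  have h0 : (k:ℝ) + n + 3/2 ≠ 0 := by positivity
  rw [e, Real.Gamma_add_one h0]
  have hk : (k.factorial:ℝ) ≠ 0 := by positivity
  have hG : Real.Gamma ((k:ℝ) + n + 3/2) ≠ 0 := (Real.Gamma_pos_of_pos (by positivity)).ne'
  field_simp

lemma hasDerivAt_FF (n : ℕ) (hn : 1 ≤ n) (y : ℝ) : HasDerivAt (FF n) (-FF (n+1) y) y := by
  have key : HasDerivAt (fun z => ∑' k : ℕ, cF n k * z ^ k)
      (∑' k : ℕ, cF n k * (k * y ^ (k-1))) y := by
    refine hasDerivAt_tsum_of_isPreconnected (g := fun (k : ℕ) (z : ℝ) => cF n k * z ^ k)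
      (g' := fun (k : ℕ) (z : ℝ) => cF n k * (k * z ^ (k-1))) (y := y) (t := Metric.ball 0 (|y|+1))
      (u := fun k : ℕ => (k:ℝ) * (|y|+1)^(k-1) / k.factorial) (y₀ := 0) ?_ Metric.isOpen_ball
      (convex_ball _ _).isPreconnected ?_ ?_ ?_ (summable_FF n hn 0) ?_
    · rw [← summable_nat_add_iff 1]
      refine (Real.summable_pow_div_factorial (|y|+1)).congr ?_
      intro k
      rw [Nat.factorial_succ]
      push_cast
      have hk : (k.factorial:ℝ) ≠ 0 := by positivity
      try simp only [Nat.add_sub_cancel]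
      field_simp
    · intro k z _
      exact (hasDerivAt_pow k z).const_mul _
    · intro k z hz
      have hz' : |z| ≤ |y|+1 := by
        have := Metric.mem_ball.1 hz
        rw [Real.dist_eq, sub_zero] at this
        exact this.le
      rw [Real.norm_eq_abs, abs_mul, abs_mul, abs_pow, Nat.abs_cast]
      have h1 := abs_cF_le n k hn
      have h2 : (k:ℝ) * |z|^(k-1) ≤ k * (|y|+1)^(k-1) := by gcongr
      calc _ ≤ (1 / (k.factorial:ℝ)) * (k * (|y|+1)^(k-1)) := by gcongr
        _ = _ := by ring
    · simp; positivity
    · simp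
  have e : (∑' k : ℕ, cF n k * (k * y ^ (k-1))) = -FF (n+1) y := by
    have hs : Summable (fun k : ℕ => cF n k * (k * y ^ (k-1))) := by
      rw [← summable_nat_add_iff 1]
      refine (summable_FF (n+1) (by omega) y).neg.congr ?_
      intro k
      have := cF_succ n k
      simp only [Nat.add_sub_cancel]
      push_cast
      rw [← mul_assoc, this]; ring
    rw [hs.tsum_eq_zero_add]
    simp only [Nat.add_sub_cancel]
    unfold FF
    rw [← tsum_neg]
    simp only [Nat.cast_zero, zero_mul, mul_zero, zero_add]
    congr 1; ext k
    have := cF_succ n k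
    push_cast
    rw [← mul_assoc, this]; ring
  rw [e] at key
  exact key

lemma FF_rec (n : ℕ) (hn : 1 ≤ n) (y : ℝ) :
    FF n y = ((n:ℝ) + 3/2) * FF (n+1) y - y * FF (n+2) y := by
  have s0 := summable_FF n hn y
  have s1 := (summable_FF (n+1) (by omega) y).mul_left ((n:ℝ)+3/2)
  have h : FF n y - ((n:ℝ) + 3/2) * FF (n+1) y = - (y * FF (n+2) y) := by
    unfold FF
    rw [← tsum_mul_left, ← s0.tsum_sub s1, (s0.sub s1).tsum_eq_zero_add, ← tsum_mul_left, ← tsum_neg]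
    have z : cF n 0 * y^0 - ((n:ℝ)+3/2) * (cF (n+1) 0 * y^0) = 0 := by
      rw [cF_eq n 0]; simp
    rw [z, zero_add]
    congr 1; ext k
    rw [cF_eq n (k+1)]
    have := cF_succ (n+1) k
    push_cast
    linear_combination y^(k+1) * this
  linarith

lemma FF_zero_pos (n : ℕ) : 0 < FF n 0 := by
  unfold FF
  rw [tsum_eq_single 0]
  · unfold cF
    have : 0 < Real.Gamma ((0:ℕ) + n + 3/2) := Real.Gamma_pos_of_pos (by positivity)
    simp only [pow_zero, Nat.factorial_zero, Nat.cast_one, one_mul, mul_one]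
    positivity
  · intro k hk; simp [hk]

/-- the unnormalised function -/
noncomputable def hh (n : ℕ) (x : ℝ) : ℝ := x ^ n * FF n (x^2/4)

noncomputable def h1 (n : ℕ) (x : ℝ) : ℝ := n * x ^ (n-1) * FF n (x^2/4) - x^(n+1)/2 * FF (n+1) (x^2/4)

lemma hasDerivAt_comp_FF (n : ℕ) (hn : 1 ≤ n) (x : ℝ) :
    HasDerivAt (fun x => FF n (x^2/4)) (-(x/2) * FF (n+1) (x^2/4)) x := by
  have a : HasDerivAt (fun x : ℝ => x^2/4) (x/2) x := by
    have := (hasDerivAt_pow 2 x).div_const 4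
    refine this.congr_deriv ?_
    norm_num; ring
  refine ((hasDerivAt_FF n hn (x^2/4)).comp x a).congr_deriv ?_
  ring

lemma hasDerivAt_hh (n : ℕ) (hn : 1 ≤ n) (x : ℝ) : HasDerivAt (hh n) (h1 n x) x := by
  refine ((hasDerivAt_pow n x).mul (hasDerivAt_comp_FF n hn x)).congr_deriv ?_
  unfold h1; ring

/-- The derivative of x^2 times the derivative of hh. -/
lemma hasDerivAt_v (n : ℕ) (hn : 1 ≤ n) (x : ℝ) :
    HasDerivAt (fun x => x^2 * h1 n x) ((n*(n+1) - x^2) * hh n x) x := by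
  obtain ⟨N, rfl⟩ : ∃ N, n = N+1 := ⟨n-1, by omega⟩
  have A := ((hasDerivAt_pow (N+2) x).const_mul ((N:ℝ)+1)).mul (hasDerivAt_comp_FF (N+1) hn x)
  have B := ((hasDerivAt_pow (N+4) x).div_const 2).mul (hasDerivAt_comp_FF (N+1+1) (by omega) x)
  have R := FF_rec (N+1) hn (x^2/4)
  refine ((A.sub B).congr_deriv ?_).congr_of_eventuallyEq (Eventually.of_forall ?_)
  · unfold hh
    push_cast at *
    rw [R]
    try simp only [show N + 2 - 1 = N+1 by omega, show N+4-1 = N+3 by omega]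
    ring
  · intro z
    simp only [h1, Pi.sub_apply, Pi.mul_apply, Nat.add_sub_cancel]
    push_cast
    ring

/-- The derivative of x times hh. -/
lemma hasDerivAt_u (n : ℕ) (hn : 1 ≤ n) (x : ℝ) :
    HasDerivAt (fun x => x * hh n x) (hh n x + x * h1 n x) x := by
  refine ((hasDerivAt_id x).mul (hasDerivAt_hh n hn x)).congr_deriv ?_
  simp

lemma hasDerivAt_u1 (n : ℕ) (hn : 1 ≤ n) (x : ℝ) (hx : 0 < x) :
    HasDerivAt (fun x => hh n x + x * h1 n x) ((n*(n+1) - x^2) * hh n x / x) x := by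
  have B : HasDerivAt (fun z => (z^2 * h1 n z) / z) _ x :=
    (hasDerivAt_v n hn x).div (hasDerivAt_id x) hx.ne'
  have C := (hasDerivAt_hh n hn x).add B
  refine (C.congr_deriv ?_).congr_of_eventuallyEq ?_
  · field_simp; ring
  · filter_upwards [lt_mem_nhds hx] with z hz
    simp only [Pi.add_apply]
    field_simp

lemma continuous_FF (n : ℕ) (hn : 1 ≤ n) : Continuous (fun x => FF n (x^2/4)) :=
  continuous_iff_continuousAt.2 fun x => (hasDerivAt_comp_FF n hn x).continuousAt

lemma continuous_hh (n : ℕ) (hn : 1 ≤ n) : Continuous (hh n) :=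
  continuous_iff_continuousAt.2 fun x => (hasDerivAt_hh n hn x).continuousAt

lemma continuous_h1 (n : ℕ) (hn : 1 ≤ n) : Continuous (h1 n) := by
  have := continuous_FF n hn
  have := continuous_FF (n+1) (by omega)
  unfold h1; fun_prop

lemma v_mono (n : ℕ) (hn : 1 ≤ n) (b : ℝ) (hb : b^2 ≤ n*(n+1))
    (hp : ∀ x, 0 < x → x < b → 0 < hh n x) :
    (∀ x, 0 < x → x ≤ b → 0 < h1 n x) := by
  intro x hx hxb
  have sm : StrictMonoOn (fun x => x^2 * h1 n x) (Set.Icc 0 b) := by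
    apply strictMonoOn_of_deriv_pos (convex_Icc _ _)
    · have := continuous_h1 n hn
      fun_prop
    · intro z hz
      rw [interior_Icc] at hz
      rw [(hasDerivAt_v n hn z).deriv]
      have := hp z hz.1 hz.2
      have : z^2 < b^2 := by nlinarith [hz.1, hz.2]
      apply mul_pos <;> linarith
  have := sm (a := 0) (b := x) ⟨le_rfl, by linarith⟩ ⟨hx.le, hxb⟩ hx
  simp only at this
  have e : (0:ℝ)^2 * h1 n 0 = 0 := by simp
  rw [e] at this
  exact pos_of_mul_pos_right this (by positivity)

lemma FF_pos (n : ℕ) (hn : 1 ≤ n) (b : ℝ) (hb : b^2 ≤ n*(n+1)) :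
    ∀ x, 0 ≤ x → x ≤ b → 0 < FF n (x^2/4) := by
  by_contra! hcon
  obtain ⟨x, hx0, hxb, hx⟩ := hcon
  set S := {z : ℝ | 0 ≤ z ∧ z ≤ b ∧ FF n (z^2/4) ≤ 0} with hS
  have hne : S.Nonempty := ⟨x, hx0, hxb, hx⟩
  have hbdd : BddBelow S := ⟨0, fun z hz => hz.1⟩
  have hcl : IsClosed S := by
    have := continuous_FF n hn
    exact (isClosed_le continuous_const continuous_id).inter
      ((isClosed_le continuous_id continuous_const).inter (isClosed_le this continuous_const))
  obtain ⟨c0, cb, hc⟩ := hcl.csInf_mem hne hbdd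
  set c := sInf S with hcdef
  have cpos : 0 < c := by
    rcases c0.lt_or_eq with h | h
    · exact h
    · rw [← h] at hc
      have := FF_zero_pos n
      norm_num at hc
      linarith
  have hp : ∀ x, 0 < x → x < c → 0 < hh n x := by
    intro z hz hzc
    unfold hh
    have : 0 < FF n (z^2/4) := by
      by_contra! hh
      have : c ≤ z := csInf_le hbdd ⟨hz.le, by linarith, hh⟩
      linarith
    positivity
  have hc2 : c^2 ≤ n*(n+1) := by nlinarith
  have h1p := v_mono n hn c hc2 hp
  have sm : StrictMonoOn (hh n) (Set.Icc 0 c) := by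
    apply strictMonoOn_of_deriv_pos (convex_Icc _ _) (continuous_hh n hn).continuousOn
    intro z hz
    rw [interior_Icc] at hz
    rw [(hasDerivAt_hh n hn z).deriv]
    exact h1p z hz.1 hz.2.le
  have h3 := sm (a := 0) (b := c) ⟨le_rfl, c0⟩ ⟨c0, le_rfl⟩ cpos
  have e : hh n 0 = 0 := by unfold hh; simp; left; omega
  rw [e] at h3
  have : hh n c ≤ 0 := by
    unfold hh
    exact mul_nonpos_of_nonneg_of_nonpos (by positivity) hc
  linarith

lemma hh_pos (n : ℕ) (hn : 1 ≤ n) (x : ℝ) (hx : 0 < x) (hb : x^2 ≤ n*(n+1)) : 0 < hh n x := by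
  have := FF_pos n hn x hb x hx.le le_rfl
  unfold hh; positivity

lemma h1_pos (n : ℕ) (hn : 1 ≤ n) (x : ℝ) (hx : 0 < x) (hb : x^2 ≤ n*(n+1)) : 0 < h1 n x :=
  v_mono n hn x hb (fun z hz hzx => hh_pos n hn z hz (by nlinarith)) x hx le_rfl

lemma hh_mono (n : ℕ) (hn : 1 ≤ n) (b : ℝ) (hb : b^2 ≤ n*(n+1)) :
    MonotoneOn (hh n) (Set.Icc 0 b) := by
  apply monotoneOn_of_deriv_nonneg (convex_Icc _ _) (continuous_hh n hn).continuousOn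
  · exact fun z _ => (hasDerivAt_hh n hn z).differentiableAt.differentiableWithinAt
  intro z hz
  rw [interior_Icc] at hz
  rw [(hasDerivAt_hh n hn z).deriv]
  exact (h1_pos n hn z hz.1 (by nlinarith [hz.1, hz.2])).le

lemma u_growth (n : ℕ) (hn : 1 ≤ n) (κ b : ℝ) (hκ : 0 ≤ κ) (hb : b^2 * (1+κ^2) ≤ n*(n+1))
    (a : ℝ) (ha : 0 ≤ a) (hab : a ≤ b) :
    a * hh n a ≤ b * hh n b * Real.exp (-(κ * (b - a))) := by
  have hb0 : b^2 ≤ n*(n+1) := by nlinarith [mul_nonneg (sq_nonneg b) (sq_nonneg κ)]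
  have ch := continuous_hh n hn
  have ch1 := continuous_h1 n hn
  have hpos : ∀ z, 0 < z → z ≤ b → 0 < hh n z := fun z h1 h2 => hh_pos n hn z h1 (by nlinarith)
  have h1pos : ∀ z, 0 < z → z ≤ b → 0 < h1 n z := fun z h1 h2 => h1_pos n hn z h1 (by nlinarith)
  have e0 : hh n 0 = 0 := by unfold hh; simp; left; omega
  have m1 : MonotoneOn (fun x => (hh n x + x * h1 n x)^2 - κ^2 * (x * hh n x)^2) (Set.Icc 0 b) := by
    have D : ∀ z ∈ interior (Set.Icc 0 b), HasDerivAt (fun x => (hh n x + x * h1 n x)^2 - κ^2 * (x * hh n x)^2)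
        (2 * (hh n z + z * h1 n z) * ((n*(n+1) - z^2) * hh n z / z) -
          κ^2 * (2 * (z * hh n z) * (hh n z + z * h1 n z))) z := by
      intro z hz
      rw [interior_Icc] at hz
      refine (((hasDerivAt_u1 n hn z hz.1).pow 2).sub (((hasDerivAt_u n hn z).pow 2).const_mul (κ^2))).congr_deriv ?_
      norm_num
    apply monotoneOn_of_deriv_nonneg (convex_Icc _ _) (by fun_prop)
    · exact fun z hz => (D z hz).differentiableAt.differentiableWithinAt
    intro z hz
    rw [(D z hz).deriv]
    rw [interior_Icc] at hz
    have p1 := hpos z hz.1 hz.2.le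
    have p2 := h1pos z hz.1 hz.2.le
    have p0 := hz.1
    have q : 0 ≤ n*(n+1) - z^2 - κ^2 * z^2 := by
      have : z^2 ≤ b^2 := by nlinarith [hz.1, hz.2]
      nlinarith [mul_le_mul_of_nonneg_right this (by positivity : 0 ≤ 1 + κ^2)]
    have : 0 ≤ 2 * (hh n z + z * h1 n z) * (hh n z / z) * (n*(n+1) - z^2 - κ^2 * z^2) := by positivity
    refine this.trans_eq ?_
    field_simp
  have le1 : ∀ z, 0 ≤ z → z ≤ b → κ * (z * hh n z) ≤ hh n z + z * h1 n z := by
    intro z hz hzb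
    have := m1 (a := 0) (b := z) ⟨le_rfl, by linarith⟩ ⟨hz, hzb⟩ hz
    simp only [e0] at this
    have t : 0 ≤ hh n z + z * h1 n z := by
      rcases hz.eq_or_lt with h | h
      · rw [← h, e0]; simp
      · have := hpos z h hzb
        have := h1pos z h hzb
        positivity
    apply abs_le_of_sq_le_sq' _ t |>.2
    nlinarith
  have m2 : MonotoneOn (fun x => (x * hh n x) * Real.exp (-(κ * x))) (Set.Icc 0 b) := by
    have D : ∀ z, HasDerivAt (fun x => (x * hh n x) * Real.exp (-(κ * x)))
        ((hh n z + z * h1 n z - κ * (z * hh n z)) * Real.exp (-(κ * z))) z := by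
      intro z
      have E : HasDerivAt (fun x => Real.exp (-(κ * x))) (Real.exp (-(κ * z)) * (-κ)) z := by
        have E0 : HasDerivAt (fun x => -(κ * x)) (-κ) z := by
          exact (((hasDerivAt_id z).const_mul κ).neg).congr_deriv (by simp)
        exact E0.exp
      refine ((hasDerivAt_u n hn z).mul E).congr_deriv ?_
      ring
    apply monotoneOn_of_deriv_nonneg (convex_Icc _ _) (by fun_prop)
    · exact fun z hz => (D z).differentiableAt.differentiableWithinAt
    intro z hz
    rw [(D z).deriv]
    rw [interior_Icc] at hz
    exact mul_nonneg (sub_nonneg.2 (le1 z hz.1.le hz.2.le)) (Real.exp_pos _).le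
  have := m2 (a := a) (b := b) ⟨ha, hab⟩ ⟨by linarith, le_rfl⟩ hab
  simp only at this
  have e1 : Real.exp (-(κ * (b - a))) = Real.exp (-(κ*b)) * Real.exp (κ*a) := by
    rw [← Real.exp_add]; congr 1; ring
  have e2 : Real.exp (-(κ*a)) * Real.exp (κ*a) = 1 := by rw [← Real.exp_add]; simp
  calc a * hh n a = (a * hh n a * Real.exp (-(κ*a))) * Real.exp (κ*a) := by rw [mul_assoc (a * hh n a), e2, mul_one]
    _ ≤ (b * hh n b * Real.exp (-(κ*b))) * Real.exp (κ*a) := by gcongr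
    _ = _ := by rw [e1]; ring

noncomputable def cc (n : ℕ) : ℝ := Real.sqrt π / 2 / 2 ^ n

lemma cc_pos (n : ℕ) : 0 < cc n := by
  have := Real.sqrt_pos.2 Real.pi_pos
  unfold cc; positivity

lemma sbesselJ_eq_of_pos (n : ℕ) (x : ℝ) (hx : 0 < x) : sbesselJ n x = cc n * hh n x := by
  have hx2 : 0 < x / 2 := by positivity
  have hb : besselJ ((n:ℝ) + 1/2) x = Real.sqrt (x/2) * ((x/2)^n * FF n (x^2/4)) := by
    unfold besselJ FF
    rw [← tsum_mul_left, ← tsum_mul_left]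
    congr 1; ext k
    have e1 : (x/2) ^ (2 * (k:ℝ) + ((n:ℝ) + 1/2)) = (x^2/4)^k * (x/2)^n * Real.sqrt (x/2) := by
      rw [Real.rpow_add hx2, Real.rpow_add hx2, Real.sqrt_eq_rpow, Real.rpow_natCast]
      have : (x/2) ^ (2 * (k:ℝ)) = (x^2/4)^k := by
        rw [show (2 * (k:ℝ)) = ((2*k : ℕ):ℝ) by push_cast; ring, Real.rpow_natCast, pow_mul]
        congr 1; ring
      rw [this]; ring
    have e2 : (k:ℝ) + ((n:ℝ) + 1/2) + 1 = (k:ℝ) + n + 3/2 := by ring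
    rw [e1, e2]
    unfold cF
    ring
  have hs : Real.sqrt (π / (2*x)) * Real.sqrt (x/2) = Real.sqrt π / 2 := by
    rw [← Real.sqrt_mul (by positivity), show π / (2*x) * (x/2) = π / 2^2 by field_simp,
      Real.sqrt_div Real.pi_pos.le, Real.sqrt_sq (by norm_num)]
  unfold sbesselJ hh cc
  rw [hb, ← mul_assoc, hs, div_pow]
  ring

lemma sbesselJ_eq (n : ℕ) (hn : 1 ≤ n) (x : ℝ) (hx : 0 ≤ x) : sbesselJ n x = cc n * hh n x := by
  rcases hx.eq_or_lt with h | h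
  · rw [← h]; unfold sbesselJ hh
    have : (0:ℝ)^n = 0 := by simp; omega
    simp [this]
  · exact sbesselJ_eq_of_pos n x h

lemma zero_gt (n : ℕ) (hn : 1 ≤ n) (α : ℝ) (hα : 0 < α) (hd : deriv (sbesselJ n) α = 0) :
    (n:ℝ)*(n+1) < α^2 := by
  by_contra! hcon
  have h := h1_pos n hn α hα hcon
  have D : HasDerivAt (sbesselJ n) (cc n * h1 n α) α := by
    refine ((hasDerivAt_hh n hn α).const_mul (cc n)).congr_of_eventuallyEq ?_
    filter_upwards [lt_mem_nhds hα] with z hz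
    exact sbesselJ_eq_of_pos n z hz
  rw [D.deriv] at hd
  have := mul_pos (cc_pos n) h
  linarith

lemma continuous_integrand (p : ℝ) (hp : 1 ≤ p) (n : ℕ) (hn : 1 ≤ n) :
    Continuous (fun z : ℝ => z ^ 2 * |cc n * hh n z| ^ p) := by
  have := continuous_hh n hn
  have h2 : Continuous (fun z : ℝ => |cc n * hh n z| ^ p) :=
    Continuous.rpow_const (by fun_prop) (fun z => Or.inr (by linarith))
  fun_prop

lemma integral_eq (p : ℝ) (n : ℕ) (hn : 1 ≤ n) (b : ℝ) (hb : 0 ≤ b) :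
    (∫ z in (0 : ℝ)..b, z ^ 2 * |sbesselJ n z| ^ p) =
      ∫ z in (0 : ℝ)..b, z ^ 2 * |cc n * hh n z| ^ p := by
  apply intervalIntegral.integral_congr
  intro z hz
  rw [Set.uIcc_of_le hb] at hz
  simp only [sbesselJ_eq n hn z hz.1]

lemma abstract_ratio (p : ℝ) (hp : 1 ≤ p) (n : ℕ) (hn : 1 ≤ n) (t : ℝ) (ht : 2 ≤ t)
    (htn : t^3 = (n:ℝ) + 1/2) (α : ℝ) (hα : 0 < α) (hα2 : (n:ℝ)*(n+1) < α^2) :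
    0 ≤ ((∫ z in (0 : ℝ)..(t^3-t^2), z ^ 2 * |sbesselJ n z| ^ p) /
    (∫ z in (0 : ℝ)..α, z ^ 2 * |sbesselJ n z| ^ p)) ^ (1 / p) ∧
    ((∫ z in (0 : ℝ)..(t^3-t^2), z ^ 2 * |sbesselJ n z| ^ p) /
    (∫ z in (0 : ℝ)..α, z ^ 2 * |sbesselJ n z| ^ p)) ^ (1 / p) ≤
      32 * t ^ (1/p) * Real.exp (-(1/3) * t) := by
  have hp0 : 0 < p := by linarith
  have t0 : 0 < t := by linarith
  have hm : (n:ℝ)*(n+1) = t^6 - 1/4 := by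
    have : (n:ℝ) = t^3 - 1/2 := by linarith
    rw [this]; ring
  set s := t^3 - t^2 with hs
  set s' := t^3 - t^2/2 with hs'
  set m := t^3 - t^2/4 with hmdef
  have t2 : 4 ≤ t^2 := by nlinarith
  have t32 : 2 * t^2 ≤ t^3 := by nlinarith
  have t4 : 16 ≤ t^4 := by nlinarith
  have t54 : 2 * t^4 ≤ t^5 := by nlinarith
  have hsl : t^3/2 ≤ s := by rw [hs]; linarith
  have hs0 : 0 < s := by have : 0 < t^3 := by positivity
                         linarith
  have hss' : s ≤ s' := by rw [hs, hs']; linarith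
  have hs'm : s' ≤ m := by rw [hmdef, hs']; linarith
  have hm2 : m^2 ≤ (n:ℝ)*(n+1) := by
    rw [hm, hmdef]
    have : (t^3 - t^2/4)^2 = t^6 - t^5/2 + t^4/16 := by ring
    rw [this]; linarith
  have hmα : m ≤ α := by
    by_contra! h
    nlinarith
  have hκ : s'^2 * (1 + (2/(3*t))^2) ≤ (n:ℝ)*(n+1) := by
    have e : s'^2 = t^6 - t^5 + t^4/4 := by rw [hs']; ring
    have e2 : (2/(3*t))^2 = 4/9/t^2 := by field_simp; norm_num
    have : s'^2 * (2/(3*t))^2 ≤ 4/9 * t^4 := by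
      have : s'^2 ≤ t^6 := by rw [e]; linarith
      rw [e2]
      calc s'^2 * (4/9/t^2) ≤ t^6 * (4/9/t^2) := by gcongr
        _ = _ := by field_simp
    rw [mul_add, mul_one, hm]
    linarith
  have G := u_growth n hn (2/(3*t)) s' (by positivity) hκ s hs0.le hss'
  have ee : -(2/(3*t) * (s' - s)) = -(1/3)*t := by
    rw [hs, hs']; field_simp; ring
  rw [ee] at G
  have ps : 0 < hh n s := hh_pos n hn s hs0 (by nlinarith)
  have ps' : 0 < hh n s' := hh_pos n hn s' (by linarith) (by nlinarith)
  have c0 := cc_pos n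
  have s't : s' ≤ t^3 := by rw [hs']; linarith
  have HH : hh n s ≤ 2 * Real.exp (-(1/3)*t) * hh n s' := by
    have : s * hh n s ≤ s * (2 * Real.exp (-(1/3)*t) * hh n s') := by
      refine G.trans ?_
      have hq : s' ≤ 2 * s := by linarith
      calc s' * hh n s' * Real.exp (-(1/3)*t) ≤ (2*s) * hh n s' * Real.exp (-(1/3)*t) := by gcongr
        _ = _ := by ring
    exact le_of_mul_le_mul_left this hs0
  have mono := hh_mono n hn m hm2
  have cont := continuous_integrand p hp n hn
  rw [integral_eq p n hn s hs0.le, integral_eq p n hn α hα.le]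
  set g := fun z : ℝ => z ^ 2 * |cc n * hh n z| ^ p with hg
  have g0 : ∀ z, 0 ≤ g z := fun z => by simp only [hg]; positivity
  have hhpos : ∀ z, 0 ≤ z → z ≤ m → 0 ≤ hh n z := by
    intro z hz hzm
    have := mono (a := 0) (b := z) ⟨le_rfl, by linarith⟩ ⟨hz, hzm⟩ hz
    have e0 : hh n 0 = 0 := by unfold hh; simp; left; omega
    linarith
  have gmono : ∀ x y, 0 ≤ x → x ≤ y → y ≤ m → g x ≤ g y := by
    intro x y hx hxy hym
    have h1 := hhpos x hx (by linarith)
    have h2 := mono (a := x) (b := y) ⟨hx, by linarith⟩ ⟨by linarith, hym⟩ hxy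
    simp only [hg]
    rw [abs_of_nonneg (by positivity), abs_of_nonneg (mul_nonneg c0.le (h1.trans h2))]
    gcongr
  have num0 : 0 ≤ ∫ z in (0:ℝ)..s, g z :=
    intervalIntegral.integral_nonneg hs0.le (fun z _ => g0 z)
  have den0 : 0 ≤ ∫ z in (0:ℝ)..α, g z :=
    intervalIntegral.integral_nonneg hα.le (fun z _ => g0 z)
  have num : ∫ z in (0:ℝ)..s, g z ≤ s * g s := by
    have := intervalIntegral.integral_mono_on (a := 0) (b := s) (μ := volume) (f := g) (g := fun _ => g s) hs0.le
      (cont.intervalIntegrable _ _) (continuous_const.intervalIntegrable _ _)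
      (fun z hz => gmono z s hz.1 hz.2 (by linarith))
    simpa using this
  have den : (t^2/4) * g s' ≤ ∫ z in (0:ℝ)..α, g z := by
    have h1 := intervalIntegral.integral_mono_on (a := s') (b := m) (μ := volume) (f := fun _ => g s') (g := g) hs'm
      (continuous_const.intervalIntegrable _ _) (cont.intervalIntegrable _ _)
      (fun z hz => gmono s' z (by linarith) hz.1 hz.2)
    have h2 := intervalIntegral.integral_mono_interval (μ := volume) (f := g) (a := s') (b := m) (c := 0) (d := α)
      (by linarith) hs'm hmα (Eventually.of_forall g0) (cont.intervalIntegrable _ _)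
    have h3 : m - s' = t^2/4 := by rw [hmdef, hs']; ring
    simp only [intervalIntegral.integral_const, smul_eq_mul, h3] at h1
    linarith
  have gs' : 0 < g s' := by
    simp only [hg]
    have : 0 < s' := by linarith
    have : 0 < |cc n * hh n s'| := abs_pos.2 (mul_pos c0 ps').ne'
    positivity
  have den1 : 0 < (t^2/4) * g s' := by positivity
  set E := 2 * Real.exp (-(1/3)*t) with hE
  have E0 : 0 < E := by positivity
  have gle : g s ≤ E^p * g s' := by
    simp only [hg]
    rw [abs_of_pos (mul_pos c0 ps), abs_of_pos (mul_pos c0 ps')]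
    have h1 : (cc n * hh n s)^p ≤ (E * (cc n * hh n s'))^p := by
      apply Real.rpow_le_rpow (by positivity) _ hp0.le
      calc cc n * hh n s ≤ cc n * (E * hh n s') := by gcongr
        _ = _ := by ring
    rw [Real.mul_rpow E0.le (by positivity)] at h1
    have h2 : s^2 ≤ s'^2 := by gcongr
    calc s^2 * (cc n * hh n s)^p ≤ s'^2 * (E^p * (cc n * hh n s')^p) := by gcongr
      _ = _ := by ring
  have ratio : (∫ z in (0:ℝ)..s, g z) / (∫ z in (0:ℝ)..α, g z) ≤ 4 * t * E^p := by
    rw [div_le_iff₀ (by linarith)]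
    have hEp : 0 < E^p := by positivity
    have hst : s ≤ t^3 := by linarith
    calc _ ≤ s * g s := num
      _ ≤ t^3 * (E^p * g s') := by gcongr
      _ = 4 * t * E^p * ((t^2/4) * g s') := by ring
      _ ≤ _ := by gcongr
  have r0 : 0 ≤ (∫ z in (0:ℝ)..s, g z) / (∫ z in (0:ℝ)..α, g z) := by positivity
  refine ⟨by positivity, ?_⟩
  have ip : 1/p ≤ 1 := by rw [div_le_one hp0]; exact hp
  have f4 : (4:ℝ)^(1/p) ≤ 4 := by
    calc (4:ℝ)^(1/p) ≤ 4^(1:ℝ) := Real.rpow_le_rpow_of_exponent_le (by norm_num) ip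
      _ = 4 := Real.rpow_one 4
  calc _ ≤ (4 * t * E^p)^(1/p) := Real.rpow_le_rpow r0 ratio (by positivity)
    _ = 4^(1/p) * t^(1/p) * E := by
      rw [Real.mul_rpow (by positivity) (by positivity), Real.mul_rpow (by norm_num) t0.le,
        ← Real.rpow_mul E0.le, mul_one_div_cancel hp0.ne', Real.rpow_one]
    _ ≤ 16 * t^(1/p) * E := by gcongr; linarith
    _ = _ := by rw [hE]; ring

lemma ballRatio_bound (p : ℝ) (hp : 1 ≤ p) (n : ℕ) (hn : 8 ≤ n)
    (α : ℝ) (hα : 0 < α) (hd : deriv (sbesselJ n) α = 0) :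
    0 ≤ ballRatio p n α ∧ ballRatio p n α <
          33 * ((n : ℝ) + 1 / 2) ^ ((1 : ℝ) / 3 + 2 / (3 * p)) *
            Real.exp (-(1 / 3) * ((n : ℝ) + 1 / 2) ^ ((1 : ℝ) / 3)) := by
  have hp0 : 0 < p := by linarith
  have hn' : (8:ℝ) ≤ n := by exact_mod_cast hn
  have hν : (0:ℝ) ≤ (n:ℝ) + 1/2 := by positivity
  obtain ⟨t, ht⟩ : ∃ t, t = ((n:ℝ) + 1/2)^((1:ℝ)/3) := ⟨_, rfl⟩
  have htn : t^3 = (n:ℝ) + 1/2 := by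
    rw [ht, ← Real.rpow_natCast, ← Real.rpow_mul hν]; norm_num
  have t0 : 0 ≤ t := by rw [ht]; positivity
  have t2 : 2 ≤ t := by
    by_contra! h
    have : t^3 < 2^3 := by gcongr
    linarith
  have hs : sseq n = t^3 - t^2 := by
    unfold sseq
    rw [htn, ht, ← Real.rpow_natCast, ← Real.rpow_mul hν]; norm_num
  have key := abstract_ratio p hp n (by omega) t t2 htn α hα (zero_gt n (by omega) α hα hd)
  unfold ballRatio
  rw [hs]
  refine ⟨key.1, key.2.trans_lt ?_⟩
  rw [← ht]
  have e : ((n:ℝ) + 1/2)^((1:ℝ)/3 + 2/(3*p)) = t^(1 + 2/p) := by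
    rw [ht, ← Real.rpow_mul hν]
    congr 1; field_simp
  rw [e]
  have h1 : t^(1/p) ≤ t^(1+2/p) := by
    apply Real.rpow_le_rpow_of_exponent_le (by linarith)
    have : 0 < 1/p := by positivity
    have e : 2/p = 2*(1/p) := by ring
    rw [e]; linarith
  have h2 : 0 < t^(1+2/p) := by have : 0 < t := by linarith
                                positivity
  apply mul_lt_mul_of_pos_right _ (Real.exp_pos _)
  linarith

theorem whispering_gallery_ball_neumann
    (p : ℝ) (hp : 1 ≤ p)
    (γ' : ℕ → ℕ → ℝ)
    (hγ'_pos : ∀ (n k : ℕ), 1 ≤ k → 0 < γ' n k)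
    (hγ'_zero : ∀ (n k : ℕ), 1 ≤ k → deriv (sbesselJ n) (γ' n k) = 0)
    (hγ'_mono : ∀ (n k l : ℕ), 1 ≤ k → k < l → γ' n k < γ' n l)
    (hγ'_surj : ∀ (n : ℕ) (x : ℝ), 0 < x → deriv (sbesselJ n) x = 0 →
      ∃ k, 1 ≤ k ∧ γ' n k = x) :
    (∃ C : ℝ, 0 < C ∧ ∀ᶠ n : ℕ in atTop, ∀ α : ℝ, 0 < α → deriv (sbesselJ n) α = 0 →
        ballRatio p n α <
          C * ((n : ℝ) + 1 / 2) ^ ((1 : ℝ) / 3 + 2 / (3 * p)) *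
            Real.exp (-(1 / 3) * ((n : ℝ) + 1 / 2) ^ ((1 : ℝ) / 3)))
    ∧ (∀ k : ℕ, 1 ≤ k →
        Tendsto (fun n : ℕ => ballRatio p n (γ' n k)) atTop (𝓝 0)) := by
  constructor
  · refine ⟨33, by norm_num, ?_⟩
    filter_upwards [eventually_ge_atTop 8] with n hn α hα hd
    exact (ballRatio_bound p hp n hn α hα hd).2
  · intro k hk
    have T : Tendsto (fun n : ℕ => ((n : ℝ) + 1 / 2)) atTop atTop :=
      tendsto_atTop_add_const_right _ _ tendsto_natCast_atTop_atTop
    have T2 := (tendsto_rpow_atTop (by norm_num : (0:ℝ) < 1/3)).comp T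
    have T3 := ((tendsto_rpow_mul_exp_neg_mul_atTop_nhds_zero (1 + 2/p) (1/3) (by norm_num)).comp T2).const_mul 33
    rw [mul_zero] at T3
    refine tendsto_of_tendsto_of_tendsto_of_le_of_le' tendsto_const_nhds T3 ?_ ?_
    · filter_upwards [eventually_ge_atTop 8] with n hn
      exact (ballRatio_bound p hp n hn _ (hγ'_pos n k hk) (hγ'_zero n k hk)).1
    · filter_upwards [eventually_ge_atTop 8] with n hn
      refine (ballRatio_bound p hp n hn _ (hγ'_pos n k hk) (hγ'_zero n k hk)).2.le.trans_eq ?_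
      simp only [Function.comp]
      rw [← Real.rpow_mul (by positivity), ← mul_assoc]
      have hp0 : p ≠ 0 := by linarith
      congr 3
      field_simp
end
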